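/- Let p ≥ 7 be a prime. Then the minimum weight d⊥ of the dual code C(2,p²)^⊥ of PG(2,p²) satisfies 2p² − 2p + 5 ≤ d⊥ ≤ 2p² − p; that is, every nonzero code word of C(2,p²)^⊥ has weight at least 2p² − 2p + 5, and there exists a nonzero code word of C(2,p²)^⊥ of weight 2p² − p. -/

import Mathlib

/-- Points of `PG(2,q)`: the 1-dimensional subspaces of `F_q ^ 3`. -/
def PGPoint (F : Type*) [Field F] : Type _ :=
  {W : Submodule F (Fin 3 → F) // Module.finrank F W = 1}

/-- Lines of `PG(2,q)`: the 2-dimensional subspaces of `F_q ^ 3`. -/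
def PGLine (F : Type*) [Field F] : Type _ :=
  {W : Submodule F (Fin 3 → F) // Module.finrank F W = 2}

/-- Incidence in `PG(2,q)`: containment of subspaces. -/
def PGIncidence (F : Type*) [Field F] : PGPoint F → PGLine F → Prop :=
  fun x l => x.1 ≤ l.1

/-- A code word of the dual code `C(Π)^⊥`: a function from points to `F_p` summing
to zero on every line. -/
def IsDualCodeWord {P L : Type*} (p : ℕ) (R : P → L → Prop) (c : P → ZMod p) : Prop :=
  ∀ l : L, ∑ᶠ x ∈ {y : P | R y l}, c x = 0

section Helpers

section
open Finset

/-- A word of the dual code of an abstract plane of order `p²`. -/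
structure PlaneCode (p : ℕ) (X Λ : Type) [Fintype X] [Fintype Λ] [DecidableEq X]
    [DecidableEq Λ] where
  pts : Λ → Finset X
  line : ∀ x y, x ≠ y → ∃! l, x ∈ pts l ∧ y ∈ pts l
  cardlines : ∀ x, #(univ.filter (fun l => x ∈ pts l)) = p ^ 2 + 1
  c : X → ZMod p
  zero : ∀ l, ∑ x ∈ pts l, c x = 0

namespace PlaneCode

variable {p : ℕ} {X Λ : Type} [Fintype X] [Fintype Λ] [DecidableEq X] [DecidableEq Λ]

/-- lines through a point -/
def thr (D : PlaneCode p X Λ) (P : X) : Finset Λ := univ.filter (fun l => P ∈ D.pts l)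

/-- indicator of a value -/
def ind (D : PlaneCode p X Λ) (b : ZMod p) (x : X) : ℤ := if D.c x = b then 1 else 0

/-- indicator of the support -/
def sup (D : PlaneCode p X Λ) (x : X) : ℤ := if D.c x = 0 then 0 else 1

/-- number of points with value `b` -/
def n (D : PlaneCode p X Λ) (b : ZMod p) : ℤ := ∑ x, D.ind b x

/-- number of points with value `b` on a line -/
def mm (D : PlaneCode p X Λ) (l : Λ) (b : ZMod p) : ℤ := ∑ x ∈ D.pts l, D.ind b x

/-- number of support points on a line -/
def sz (D : PlaneCode p X Λ) (l : Λ) : ℤ := ∑ x ∈ D.pts l, D.sup x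

/-- weight -/
def w (D : PlaneCode p X Λ) : ℤ := ∑ x, D.sup x

/-- integer representative of the value scaled by `b⁻¹` -/
def r (D : PlaneCode p X Λ) (b : ZMod p) (x : X) : ℤ := ((D.c x * b⁻¹).val : ℤ)

/-- total of the representatives -/
def T (D : PlaneCode p X Λ) (b : ZMod p) : ℤ := ∑ x, D.r b x

/-- line sum divided by `p` -/
def k (D : PlaneCode p X Λ) (b : ZMod p) (l : Λ) : ℤ := (∑ x ∈ D.pts l, D.r b x) / p

/-- the excess -/
def E (D : PlaneCode p X Λ) (b : ZMod p) : ℤ := D.T b / p - (p ^ 2 - p + 1)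

variable (D : PlaneCode p X Λ)

lemma mem_thr {P : X} {l : Λ} : l ∈ D.thr P ↔ P ∈ D.pts l := by simp [thr]

lemma card_thr (P : X) : (#(D.thr P) : ℤ) = p ^ 2 + 1 := by
  have := D.cardlines P
  unfold thr
  rw [this]; push_cast; ring

lemma dc (g : X → ℤ) (P : X) :
    ∑ l ∈ D.thr P, ∑ x ∈ D.pts l, g x = ∑ x, g x + p ^ 2 * g P := by
  have h1 : ∑ l ∈ D.thr P, ∑ x ∈ D.pts l, g x
      = ∑ x, ∑ l ∈ D.thr P, if x ∈ D.pts l then g x else 0 := by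
    rw [sum_comm]
    apply sum_congr rfl
    intro l _
    rw [← sum_filter]; congr 1; ext x; simp
  rw [h1]
  have h2 : ∀ x, (∑ l ∈ D.thr P, if x ∈ D.pts l then g x else 0)
      = g x + if x = P then p ^ 2 * g P else 0 := by
    intro x
    by_cases hx : x = P
    · subst hx
      rw [sum_congr rfl (g := fun _ => g x)]
      · rw [sum_const, nsmul_eq_mul, D.card_thr]; simp; ring
      · intro l hl; simp [D.mem_thr.1 hl]
    · obtain ⟨l, hl, hu⟩ := D.line x P hx
      rw [sum_eq_single l]
      · simp [hx, hl.1]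
      · intro l' hl' hne
        rw [if_neg]
        intro h
        exact hne (hu l' ⟨h, D.mem_thr.1 hl'⟩)
      · intro h
        exact absurd (D.mem_thr.2 hl.2) h
  rw [sum_congr rfl (fun x _ => h2 x), sum_add_distrib]
  simp

lemma ind_nonneg (b : ZMod p) (x : X) : 0 ≤ D.ind b x := by unfold ind; split_ifs <;> simp
lemma sup_nonneg (x : X) : 0 ≤ D.sup x := by unfold sup; split_ifs <;> simp
lemma n_nonneg (b : ZMod p) : 0 ≤ D.n b := sum_nonneg fun _ _ => D.ind_nonneg _ _
lemma mm_nonneg (l : Λ) (b : ZMod p) : 0 ≤ D.mm l b := sum_nonneg fun _ _ => D.ind_nonneg _ _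
lemma r_nonneg (b : ZMod p) (x : X) : 0 ≤ D.r b x := by unfold r; positivity

lemma ind_self {b : ZMod p} {x : X} (h : D.c x = b) : D.ind b x = 1 := by simp [ind, h]
lemma ind_ne {b : ZMod p} {x : X} (h : D.c x ≠ b) : D.ind b x = 0 := by simp [ind, h]

lemma sum_mm (b : ZMod p) (P : X) : ∑ l ∈ D.thr P, D.mm l b = D.n b + p ^ 2 * D.ind b P :=
  D.dc _ P

lemma sum_sz (P : X) : ∑ l ∈ D.thr P, D.sz l = D.w + p ^ 2 * D.sup P := D.dc _ P

lemma mm_pos {l : Λ} {b : ZMod p} {x : X} (hx : x ∈ D.pts l) (hb : D.c x = b) :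
    1 ≤ D.mm l b := by
  have := single_le_sum (f := fun x => D.ind b x) (fun i _ => D.ind_nonneg b i) hx
  simp only [D.ind_self hb] at this
  exact this

lemma exists_of_mm {l : Λ} {b : ZMod p} (h : 1 ≤ D.mm l b) : ∃ x ∈ D.pts l, D.c x = b := by
  by_contra! hc
  have : D.mm l b = 0 := sum_eq_zero fun x hx => D.ind_ne (hc x hx)
  omega

lemma n_pos {b : ZMod p} {x : X} (hb : D.c x = b) : 1 ≤ D.n b := by
  have := single_le_sum (f := fun x => D.ind b x) (fun i _ => D.ind_nonneg b i) (mem_univ x)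
  simp only [D.ind_self hb] at this
  exact this

lemma exists_of_n {b : ZMod p} (h : 1 ≤ D.n b) : ∃ x, D.c x = b := by
  by_contra! hc
  have : D.n b = 0 := sum_eq_zero fun x _ => D.ind_ne (hc x)
  omega

variable [hp : Fact p.Prime]

lemma ppos : (0 : ℤ) < p := by exact_mod_cast hp.out.pos

lemma pk (b : ZMod p) (l : Λ) : (p : ℤ) * D.k b l = ∑ x ∈ D.pts l, D.r b x := by
  unfold k
  apply Int.mul_ediv_cancel'
  rw [← ZMod.intCast_zmod_eq_zero_iff_dvd _ p]
  unfold r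
  push_cast
  simp only [ZMod.natCast_val, ZMod.cast_id', id_eq]
  rw [← sum_mul, D.zero]; simp

lemma k_nonneg (b : ZMod p) (l : Λ) : 0 ≤ D.k b l := by
  have h := D.pk b l
  have h2 : 0 ≤ ∑ x ∈ D.pts l, D.r b x := sum_nonneg fun _ _ => D.r_nonneg _ _
  have := ppos (p := p)
  by_contra! hc
  nlinarith

lemma T_dvd (b : ZMod p) (P : X) : (p : ℤ) ∣ D.T b := by
  have h := D.dc (D.r b) P
  have h2 : ∑ l ∈ D.thr P, ∑ x ∈ D.pts l, D.r b x = p * ∑ l ∈ D.thr P, D.k b l := by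
    rw [mul_sum]; exact sum_congr rfl fun l _ => (D.pk b l).symm
  have : D.T b = p * (∑ l ∈ D.thr P, D.k b l - p * D.r b P) := by
    have : D.T b = ∑ x, D.r b x := rfl
    rw [mul_sub, ← h2, this]; linarith
  exact ⟨_, this⟩

lemma T_eq (b : ZMod p) (P : X) : D.T b = p * (p ^ 2 - p + 1 + D.E b) := by
  have h := Int.mul_ediv_cancel' (D.T_dvd b P)
  unfold E; rw [← h]
  rw [Int.mul_ediv_cancel_left _ (ppos (p := p)).ne']; ring

lemma sum_k (b : ZMod p) (P : X) :
    ∑ l ∈ D.thr P, D.k b l = p ^ 2 - p + 1 + D.E b + p * D.r b P := by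
  have h := D.dc (D.r b) P
  have h2 : ∑ l ∈ D.thr P, ∑ x ∈ D.pts l, D.r b x = p * ∑ l ∈ D.thr P, D.k b l := by
    rw [mul_sum]; exact sum_congr rfl fun l _ => (D.pk b l).symm
  have h3 : ∑ x, D.r b x = p * (p ^ 2 - p + 1 + D.E b) := D.T_eq b P
  rw [h2, h3] at h
  have := (ppos (p := p)).ne'
  apply mul_left_cancel₀ this
  rw [h]; ring

lemma sum_k1 (b : ZMod p) (P : X) :
    ∑ l ∈ D.thr P, (D.k b l - 1) = D.E b + p * (D.r b P - 1) := by
  rw [sum_sub_distrib, D.sum_k, sum_const, nsmul_eq_mul, D.card_thr]; ring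

lemma r_self {b : ZMod p} (hb : b ≠ 0) {x : X} (h : D.c x = b) : D.r b x = 1 := by
  unfold r; rw [h, mul_inv_cancel₀ hb]
  have : Fact (1 < p) := ⟨hp.out.one_lt⟩
  rw [ZMod.val_one]; rfl

lemma r_pos {b : ZMod p} (hb : b ≠ 0) {x : X} (h : D.c x ≠ 0) : 1 ≤ D.r b x := by
  unfold r
  have : (D.c x * b⁻¹) ≠ 0 := mul_ne_zero h (inv_ne_zero hb)
  have := (ZMod.val_ne_zero _).2 this
  omega

lemma r_zero {b : ZMod p} {x : X} (h : D.c x = 0) : D.r b x = 0 := by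
  unfold r; rw [h]; simp

lemma r_add {b : ZMod p} (hb : b ≠ 0) (x : X) : D.r b x + D.r (-b) x = p * D.sup x := by
  by_cases h : D.c x = 0
  · simp [r_zero, h, sup]
  · have hh : (D.c x * b⁻¹) ≠ 0 := mul_ne_zero h (inv_ne_zero hb)
    unfold r sup
    have : NeZero (D.c x * b⁻¹) := ⟨hh⟩
    rw [inv_neg, mul_neg, ZMod.val_neg_of_ne_zero, if_neg h]
    have := ZMod.val_lt (D.c x * b⁻¹)
    push_cast [this.le]; ring

lemma r_neg_self {b : ZMod p} (hb : b ≠ 0) {x : X} (h : D.c x = -b) : D.r b x = p - 1 := by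
  have h1 := D.r_add hb x
  have h2 := D.r_self (neg_ne_zero.2 hb) h
  have : D.sup x = 1 := by unfold sup; rw [if_neg]; rw [h]; exact neg_ne_zero.2 hb
  rw [this] at h1; linarith

lemma k_add {b : ZMod p} (hb : b ≠ 0) (l : Λ) : D.k b l + D.k (-b) l = D.sz l := by
  apply mul_left_cancel₀ (ppos (p := p)).ne'
  rw [mul_add, D.pk, D.pk, ← sum_add_distrib, sz, mul_sum]
  exact sum_congr rfl fun x _ => D.r_add hb x

lemma E_add {b : ZMod p} (hb : b ≠ 0) (P : X) :
    D.E b + D.E (-b) = D.w - 2 * (p ^ 2 - p + 1) := by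
  have h1 := D.T_eq b P
  have h2 := D.T_eq (-b) P
  have h3 : D.T b + D.T (-b) = p * D.w := by
    unfold T w
    rw [← sum_add_distrib, mul_sum]
    exact sum_congr rfl fun x _ => D.r_add hb x
  rw [h1, h2] at h3
  have := (ppos (p := p)).ne'
  apply mul_left_cancel₀ this
  linarith

lemma k_pos {b : ZMod p} (hb : b ≠ 0) {l : Λ} {P : X} (hP : P ∈ D.pts l) (hc : D.c P ≠ 0) :
    1 ≤ D.k b l := by
  have h := D.pk b l
  have h2 := single_le_sum (f := fun x => D.r b x) (fun i _ => D.r_nonneg b i) hP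
  have h3 := D.r_pos hb hc
  have := ppos (p := p)
  by_contra! hc
  nlinarith

lemma E_nonneg {b : ZMod p} (hb : b ≠ 0) {P : X} (h : D.c P = b) : 0 ≤ D.E b := by
  have h1 := D.sum_k1 b P
  rw [D.r_self hb h] at h1
  have : 0 ≤ ∑ l ∈ D.thr P, (D.k b l - 1) := sum_nonneg fun l hl => by
    have := D.k_pos hb (D.mem_thr.1 hl) (by rw [h]; exact hb)
    omega
  linarith

end PlaneCode

end

section
open Finset
namespace PlaneCode
variable {p : ℕ} {X Λ : Type} [Fintype X] [Fintype Λ] [DecidableEq X] [DecidableEq Λ]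
variable (D : PlaneCode p X Λ)

lemma sup_self {b : ZMod p} (hb : b ≠ 0) {x : X} (h : D.c x = b) : D.sup x = 1 := by
  unfold sup; rw [if_neg]; rw [h]; exact hb

lemma mm_le_sz {l : Λ} {b : ZMod p} (hb : b ≠ 0) : D.mm l b ≤ D.sz l := by
  unfold mm sz ind sup
  apply sum_le_sum
  intro x _
  split_ifs with h1 h2 <;> simp_all

lemma mm_add_le_sz {l : Λ} {b d : ZMod p} (hb : b ≠ 0) (hd : d ≠ 0) (h : b ≠ d) :
    D.mm l b + D.mm l d ≤ D.sz l := by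
  unfold mm sz ind sup
  rw [← sum_add_distrib]
  apply sum_le_sum
  intro x _
  split_ifs with h1 h2 <;> simp_all

/-- support points of a line -/
def spt (l : Λ) : Finset X := (D.pts l).filter (fun x => D.c x ≠ 0)

lemma sz_eq (l : Λ) : D.sz l = #(D.spt l) := by
  unfold sz spt sup
  rw [card_filter]; push_cast
  apply sum_congr rfl; intro x _; split_ifs <;> simp_all

lemma mm_eq {l : Λ} {b : ZMod p} (hb : b ≠ 0) :
    D.mm l b = ∑ x ∈ D.spt l, (if b = D.c x then 1 else 0) := by
  unfold mm spt ind
  rw [sum_filter]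
  apply sum_congr rfl; intro x _
  by_cases h1 : D.c x = b
  · rw [if_pos h1, if_pos (h1 ▸ hb), if_pos h1.symm]
  · rw [if_neg h1, if_neg (show ¬ b = D.c x from fun h => h1 h.symm)]; simp

lemma zero_spt (l : Λ) : ∑ x ∈ D.spt l, D.c x = 0 := by
  have := D.zero l
  rw [← this]; unfold spt; rw [sum_filter]
  apply sum_congr rfl; intro x _
  split_ifs with h1 <;> simp_all

lemma mem_spt {l : Λ} {x : X} : x ∈ D.spt l ↔ x ∈ D.pts l ∧ D.c x ≠ 0 := by simp [spt]

lemma two_line {l : Λ} {P : X} {b : ZMod p} (hP : P ∈ D.pts l) (hc : D.c P = b) (hb : b ≠ 0)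
    (h : D.sz l = 2) :
    ∀ x, x ≠ 0 → D.mm l x = (if x = b then 1 else 0) + (if x = -b then 1 else 0) := by
  have hm : P ∈ D.spt l := D.mem_spt.2 ⟨hP, hc ▸ hb⟩
  have hz := D.zero_spt l
  rw [sz_eq] at h
  have h1 : #((D.spt l).erase P) = 1 := by rw [card_erase_of_mem hm]; omega
  obtain ⟨Q, hQ⟩ := card_eq_one.1 h1
  have h2 : D.spt l = insert P {Q} := by rw [← hQ, insert_erase hm]
  have hPQ : P ∉ ({Q} : Finset X) := by rw [← hQ]; simp
  rw [h2, sum_insert hPQ, sum_singleton, hc] at hz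
  intro x hx
  rw [D.mm_eq hx, h2, sum_insert hPQ, sum_singleton, hc]
  rw [show D.c Q = -b by linear_combination hz]

lemma three_line {l : Λ} {P : X} {b : ZMod p} (hP : P ∈ D.pts l) (hc : D.c P = b) (hb : b ≠ 0)
    (h : D.sz l = 3) :
    ∃ y, y ≠ 0 ∧ -b - y ≠ 0 ∧ ∀ x, x ≠ 0 → D.mm l x =
      (if x = b then 1 else 0) + (if x = y then 1 else 0) + (if x = -b - y then 1 else 0) := by
  have hm : P ∈ D.spt l := D.mem_spt.2 ⟨hP, hc ▸ hb⟩
  have hz := D.zero_spt l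
  rw [sz_eq] at h
  have h1 : #((D.spt l).erase P) = 2 := by rw [card_erase_of_mem hm]; omega
  obtain ⟨Q, R, hQR, hQ⟩ := card_eq_two.1 h1
  have h2 : D.spt l = insert P {Q, R} := by rw [← hQ, insert_erase hm]
  have hPQ : P ∉ ({Q, R} : Finset X) := by rw [← hQ]; simp
  rw [h2, sum_insert hPQ, sum_pair hQR, hc] at hz
  have e1 : D.c R = -b - D.c Q := by linear_combination hz
  have hQ0 : D.c Q ≠ 0 := (D.mem_spt (l := l).1 (by rw [h2]; simp)).2
  have hR0 : D.c R ≠ 0 := (D.mem_spt (l := l).1 (by rw [h2]; simp)).2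
  refine ⟨D.c Q, hQ0, e1 ▸ hR0, fun x hx => ?_⟩
  rw [D.mm_eq hx, h2, sum_insert hPQ, sum_pair hQR, hc, e1]; ring

variable [hp : Fact p.Prime]

lemma sz_ge2 {l : Λ} {P : X} (hP : P ∈ D.pts l) (hc : D.c P ≠ 0) : 2 ≤ D.sz l := by
  have h1 := D.k_add hc l
  have h2 := D.k_pos hc hP hc
  have h3 := D.k_pos (neg_ne_zero.2 hc) hP hc
  omega

lemma ne_neg (hp7 : 7 ≤ p) {b : ZMod p} (hb : b ≠ 0) : b ≠ -b := by
  intro h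
  have : (2 : ZMod p) * b = 0 := by linear_combination h
  rcases mul_eq_zero.1 this with h | h
  · have : ((2 : ℕ) : ZMod p) = 0 := by exact_mod_cast h
    rw [ZMod.natCast_eq_zero_iff] at this
    have := Nat.le_of_dvd (by norm_num) this
    omega
  · exact hb h

lemma small_ne (hp7 : 7 ≤ p) (m : ℕ) (h0 : 0 < m) (h1 : m < 7) : (m : ZMod p) ≠ 0 := by
  intro h
  rw [ZMod.natCast_eq_zero_iff] at h
  have := Nat.le_of_dvd h0 h
  omega

/-- the excess of the weight -/
def e (D : PlaneCode p X Λ) : ℤ := D.w - 2 * (p ^ 2 - p + 1)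

/-- the nonnegative line function through a point of value `b` -/
def f (D : PlaneCode p X Λ) (b : ZMod p) (l : Λ) : ℤ := D.mm l (-b) + D.sz l - 3

lemma f_two (hp7 : 7 ≤ p) {l : Λ} {P : X} {b : ZMod p} (hP : P ∈ D.pts l) (hc : D.c P = b)
    (hb : b ≠ 0) (h : D.sz l = 2) : D.f b l = 0 := by
  have := D.two_line hP hc hb h (-b) (neg_ne_zero.2 hb)
  unfold f
  rw [this, h, if_neg (ne_neg hp7 hb).symm]; simp

lemma f_ge (hp7 : 7 ≤ p) {l : Λ} {P : X} {b : ZMod p} (hP : P ∈ D.pts l) (hc : D.c P = b)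
    (hb : b ≠ 0) : 0 ≤ D.f b l ∧ D.sz l - 3 ≤ D.f b l := by
  have h2 := D.sz_ge2 hP (hc ▸ hb)
  have := D.mm_nonneg l (-b)
  rcases h2.eq_or_lt with h | h
  · have := D.f_two hp7 hP hc hb h.symm; omega
  · unfold f; omega

lemma sum_f (hp7 : 7 ≤ p) {P : X} {b : ZMod p} (hc : D.c P = b) (hb : b ≠ 0) :
    ∑ l ∈ D.thr P, D.f b l = D.n (-b) - (2 * p + 1 - D.e) := by
  unfold f e
  rw [sum_sub_distrib, sum_add_distrib, D.sum_mm, D.sum_sz, D.sup_self hb hc,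
    D.ind_ne (by rw [hc]; exact ne_neg hp7 hb), sum_const, nsmul_eq_mul, D.card_thr]
  ring

lemma n_neg_ge (hp7 : 7 ≤ p) {P : X} {b : ZMod p} (hc : D.c P = b) (hb : b ≠ 0) :
    2 * p + 1 - D.e ≤ D.n (-b) := by
  have h := D.sum_f hp7 hc hb
  have : 0 ≤ ∑ l ∈ D.thr P, D.f b l := sum_nonneg fun l hl =>
    (D.f_ge hp7 (D.mem_thr.1 hl) hc hb).1
  linarith

/-- three point lines are not through `b` and `-b` -/
lemma three_neg (hp7 : 7 ≤ p) {l : Λ} {P : X} {b : ZMod p} (hP : P ∈ D.pts l) (hc : D.c P = b)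
    (hb : b ≠ 0) (h : D.sz l = 3) : D.mm l (-b) = 0 := by
  obtain ⟨y, hy, hy2, hm⟩ := D.three_line hP hc hb h
  rw [hm _ (neg_ne_zero.2 hb), if_neg (ne_neg hp7 hb).symm, if_neg, if_neg]
  · simp
  · intro h; exact hy (by linear_combination h)
  · intro h; exact hy2 (by linear_combination h)

/-- symmetry on short lines -/
lemma sym_short {l : Λ} {P : X} {b : ZMod p} (hP : P ∈ D.pts l)
    (hc : D.c P = b) (hb : b ≠ 0) (h : D.sz l ≤ 3) {x : ZMod p} (hx : x ≠ 0) (hx2 : x ≠ -b) :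
    D.mm l x - (if x = b then 1 else 0) = D.mm l (-b - x) - (if -b - x = b then 1 else 0) := by
  have h2 := D.sz_ge2 hP (hc ▸ hb)
  have hx3 : -b - x ≠ 0 := fun h => hx2 (by linear_combination -h)
  have hx4 : -b - x ≠ -b := fun h => hx (by linear_combination -h)
  rcases h2.eq_or_lt with h | h
  · rw [D.two_line hP hc hb h.symm x hx, D.two_line hP hc hb h.symm _ hx3, if_neg hx2, if_neg hx4]
    ring
  · obtain ⟨y, hy, hy2, hm⟩ := D.three_line hP hc hb (by omega)
    rw [hm x hx, hm _ hx3]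
    have e1 : (-b - x = y) ↔ (x = -b - y) :=
      ⟨fun h => by linear_combination -h, fun h => by linear_combination -h⟩
    have e2 : (-b - x = -b - y) ↔ (x = y) :=
      ⟨fun h => by linear_combination -h, fun h => by linear_combination -h⟩
    simp only [e1, e2]; ring

lemma sym_all {P : X} {b : ZMod p} (hc : D.c P = b) (x : ZMod p) :
    ∑ l ∈ D.thr P, ((D.mm l x - (if x = b then 1 else 0))
      - (D.mm l (-b - x) - (if -b - x = b then 1 else 0)))
    = (D.n x - (if x = b then 1 else 0)) - (D.n (-b - x) - (if -b - x = b then 1 else 0)) := by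
  rw [sum_sub_distrib, sum_sub_distrib, sum_sub_distrib, D.sum_mm, D.sum_mm, sum_const, sum_const,
    nsmul_eq_mul, nsmul_eq_mul, D.card_thr]
  simp only [ind, hc, eq_comm (a := b)]
  ring

/-- all lines short -/
lemma good0 (hp7 : 7 ≤ p) {P : X} {b : ZMod p} (hc : D.c P = b) (hb : b ≠ 0)
    (hn : D.n (-b) = 2 * p + 1 - D.e) : ∀ l, P ∈ D.pts l → D.sz l ≤ 3 := by
  have h := D.sum_f hp7 hc hb
  rw [hn, sub_self] at h
  have h2 := (sum_eq_zero_iff_of_nonneg fun l hl => (D.f_ge hp7 (D.mem_thr.1 hl) hc hb).1).1 h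
  intro l hl
  have h3 := h2 l (D.mem_thr.2 hl)
  have := (D.f_ge hp7 hl hc hb).2
  omega

/-- exactly one line of size four -/
lemma good1 (hp7 : 7 ≤ p) {P : X} {b : ZMod p} (hc : D.c P = b) (hb : b ≠ 0)
    (hn : D.n (-b) = 2 * p + 2 - D.e) : ∃ Q, P ∈ D.pts Q ∧ D.sz Q = 4 ∧ D.mm Q (-b) = 0 ∧
      ∀ l, P ∈ D.pts l → l ≠ Q → D.sz l ≤ 3 := by
  have h := D.sum_f hp7 hc hb
  have hnn : ∀ l ∈ D.thr P, 0 ≤ D.f b l := fun l hl => (D.f_ge hp7 (D.mem_thr.1 hl) hc hb).1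
  rw [hn] at h
  have h' : ∑ l ∈ D.thr P, D.f b l = 1 := by rw [h]; ring
  have hex : ∃ Q ∈ D.thr P, 1 ≤ D.f b Q := by
    by_contra! hcon
    have : ∑ l ∈ D.thr P, D.f b l ≤ 0 := sum_nonpos fun l hl => by
      have := hcon l hl; omega
    omega
  obtain ⟨Q, hQ, hQ1⟩ := hex
  rw [← add_sum_erase _ _ hQ] at h'
  have hnn2 : ∀ l ∈ (D.thr P).erase Q, 0 ≤ D.f b l := fun l hl => hnn l (mem_of_mem_erase hl)
  have hs := sum_nonneg hnn2
  have hs0 : ∑ l ∈ (D.thr P).erase Q, D.f b l = 0 := by omega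
  have hQf : D.f b Q = 1 := by omega
  have h2 := (sum_eq_zero_iff_of_nonneg hnn2).1 hs0
  have hPQ := D.mem_thr.1 hQ
  have g1 := D.sz_ge2 hPQ (hc ▸ hb)
  have g2 : D.sz Q ≠ 2 := fun h => by have := D.f_two hp7 hPQ hc hb h; omega
  have g3 : D.sz Q ≠ 3 := fun h => by
    have := D.three_neg hp7 hPQ hc hb h
    unfold f at hQf; omega
  have g4 := D.mm_nonneg Q (-b)
  unfold f at hQf
  refine ⟨Q, hPQ, by omega, by omega, fun l hl hne => ?_⟩
  have h3 := h2 l (mem_erase.2 ⟨hne, D.mem_thr.2 hl⟩)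
  have := (D.f_ge hp7 hl hc hb).2
  omega

lemma sym0 (hp7 : 7 ≤ p) {P : X} {b : ZMod p} (hc : D.c P = b) (hb : b ≠ 0)
    (hn : D.n (-b) = 2 * p + 1 - D.e) {x : ZMod p} (hx : x ≠ 0) (hx2 : x ≠ -b) :
    D.n x - (if x = b then 1 else 0) = D.n (-b - x) - (if -b - x = b then 1 else 0) := by
  have h := D.sym_all hc x
  rw [sum_eq_zero] at h
  · linarith
  · intro l hl
    have := D.sym_short (D.mem_thr.1 hl) hc hb (D.good0 hp7 hc hb hn l (D.mem_thr.1 hl)) hx hx2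
    linarith

lemma sym1 {P : X} {b : ZMod p} (hc : D.c P = b) (hb : b ≠ 0) {Q : Λ} (hPQ : P ∈ D.pts Q)
    (hQ : ∀ l, P ∈ D.pts l → l ≠ Q → D.sz l ≤ 3) {x : ZMod p} (hx : x ≠ 0) (hx2 : x ≠ -b) :
    D.n x - D.mm Q x = D.n (-b - x) - D.mm Q (-b - x) := by
  have h := D.sym_all hc x
  rw [sum_eq_single_of_mem Q (D.mem_thr.2 hPQ)] at h
  · linarith
  · intro l hl hne
    have := D.sym_short (D.mem_thr.1 hl) hc hb (hQ l (D.mem_thr.1 hl) hne) hx hx2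
    linarith

end PlaneCode

end

section
open Finset
namespace PlaneCode
variable {p : ℕ} {X Λ : Type} [Fintype X] [Fintype Λ] [DecidableEq X] [DecidableEq Λ]
variable (D : PlaneCode p X Λ)
variable [hp : Fact p.Prime]

lemma r_of {b d : ZMod p} {x : X} (h : D.c x = d) : D.r b x = ((d * b⁻¹).val : ℤ) := by
  unfold r; rw [h]

lemma sum_r_ge2 (b : ZMod p) {d d' : ZMod p} (h : d ≠ d') (l : Λ) :
    ((d * b⁻¹).val : ℤ) * D.mm l d + ((d' * b⁻¹).val : ℤ) * D.mm l d' ≤ p * D.k b l := by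
  rw [D.pk]
  unfold mm
  rw [mul_sum, mul_sum, ← sum_add_distrib]
  apply sum_le_sum
  intro x _
  by_cases h1 : D.c x = d
  · rw [D.ind_self h1, D.ind_ne (by rw [h1]; exact h), D.r_of h1]; simp
  · by_cases h2 : D.c x = d'
    · rw [D.ind_self h2, D.ind_ne h1, D.r_of h2]; simp
    · rw [D.ind_ne h2, D.ind_ne h1]; simp [D.r_nonneg]

lemma val_neg_ratio {b d : ZMod p} (hb : b ≠ 0) (hd : d ≠ 0) :
    (((-d) * b⁻¹).val : ℤ) = p - (d * b⁻¹).val := by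
  have : NeZero (d * b⁻¹) := ⟨mul_ne_zero hd (inv_ne_zero hb)⟩
  rw [neg_mul, ZMod.val_neg_of_ne_zero]
  have := ZMod.val_lt (d * b⁻¹)
  push_cast [this.le]; ring

lemma val_self_ratio {b : ZMod p} (hb : b ≠ 0) : ((b * b⁻¹).val : ℤ) = 1 := by
  rw [mul_inv_cancel₀ hb]
  have : Fact (1 < p) := ⟨hp.out.one_lt⟩
  rw [ZMod.val_one]; rfl

lemma lemU {b d : ZMod p} (hb : b ≠ 0) (hd : d ≠ 0) (hne : d ≠ -b) {R : X} (hR : D.c R = d) :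
    (((d * b⁻¹).val : ℤ) - 1) * D.n (-b)
      ≤ ((d * b⁻¹).val : ℤ) * (p * (((d * b⁻¹).val : ℤ) - 1) + D.E b) := by
  set δ : ℤ := ((d * b⁻¹).val : ℤ) with hδ
  have hδ1 : 1 ≤ δ := by have := D.r_pos hb (x := R) (hR ▸ hd); rw [D.r_of hR] at this; exact this
  have hδp : δ < p := by have := ZMod.val_lt (d * b⁻¹); omega
  have hs := D.sum_k1 b R
  rw [D.r_of hR, ← hδ] at hs
  have hm := D.sum_mm (-b) R
  rw [D.ind_ne (by rw [hR]; exact hne)] at hm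
  have key : ∀ l ∈ D.thr R, (δ - 1) * D.mm l (-b) ≤ δ * (D.k b l - 1) := by
    intro l hl
    have hl := D.mem_thr.1 hl
    have h1 := D.sum_r_ge2 b hne l
    rw [val_neg_ratio hb hb, val_self_ratio hb, ← hδ] at h1
    have h2 := D.mm_pos hl hR
    have h3 := D.k_pos hb hl (hR ▸ hd)
    have h4 := D.mm_nonneg l (-b)
    set t := D.mm l (-b)
    set k := D.k b l
    set s := D.mm l d
    have h5 : δ + (p - 1) * t ≤ p * k := by nlinarith
    have hpp := ppos (p := p)
    rcases le_or_gt δ t with ht | ht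
    · have h6 : 0 ≤ (p - δ) * (t - δ) := mul_nonneg (by omega) (by omega)
      have h7 := mul_le_mul_of_nonneg_left h5 (show 0 ≤ δ by omega)
      have : (p : ℤ) * ((δ - 1) * t) ≤ p * (δ * (k - 1)) := by nlinarith
      exact le_of_mul_le_mul_left this hpp
    · have : t < k := by
        by_contra! hcon
        nlinarith
      nlinarith
  have := sum_le_sum key
  rw [← mul_sum, ← mul_sum, hm, hs] at this
  linarith

/-- the second main inequality, with `a = -b` -/
lemma lemL {a d : ZMod p} (ha : a ≠ 0) {μ : ℤ} (hμ2 : 2 ≤ μ) (hμp : 2 * μ + 1 ≤ p)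
    (hd : ((d * a⁻¹).val : ℤ) = p - μ)
    (hmin : ∀ x, D.c x ≠ 0 → D.c x ≠ a → μ ≤ D.r a x) {P : X} (hP : D.c P = a) :
    (μ - 1) * (D.n d - 3 * D.E a) ≤ D.n a - 1 := by
  have hda : d ≠ a := by
    rintro rfl
    rw [val_self_ratio ha] at hd; omega
  have hs := D.sum_k1 a P
  rw [D.r_self ha hP] at hs
  have hm := D.sum_mm a P
  have hm2 := D.sum_mm d P
  rw [D.ind_ne (by rw [hP]; exact hda.symm)] at hm2
  rw [D.ind_self hP] at hm
  have key : ∀ l ∈ D.thr P, (μ - 1) * (D.mm l d - 3 * (D.k a l - 1)) ≤ D.mm l a - 1 := by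
    intro l hl
    have hl := D.mem_thr.1 hl
    have h1 := D.sum_r_ge2 a hda l
    rw [hd, val_self_ratio ha] at h1
    have h2 := D.mm_pos hl hP
    have h3 := D.k_pos ha hl (hP ▸ ha)
    have h4 := D.mm_nonneg l d
    rcases h3.eq_or_lt with hk | hk
    · rw [← hk] at h1 ⊢
      rcases h4.eq_or_lt with h0 | h0
      · rw [← h0]; linarith
      have hs1 : D.mm l d = 1 := by
        by_contra hne
        have : 2 ≤ D.mm l d := by omega
        nlinarith
      rw [hs1]
      -- either t = μ or there is a further point
      by_cases hex : ∃ x ∈ D.pts l, D.c x ≠ 0 ∧ D.c x ≠ a ∧ D.c x ≠ d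
      · exfalso
        obtain ⟨x, hx, hx0, hxa, hxd⟩ := hex
        have h5 := D.sum_r_ge2 a (d := d) (d' := D.c x) (Ne.symm hxd) l
        have h6 := hmin x hx0 hxa
        rw [D.r_of rfl] at h6
        have h7 := D.mm_pos hx rfl
        have hpk := D.pk a l
        have : ((d * a⁻¹).val : ℤ) * D.mm l d + ((a * a⁻¹).val : ℤ) * D.mm l a
            + ((D.c x * a⁻¹).val : ℤ) * D.mm l (D.c x) ≤ p * D.k a l := by
          rw [D.pk]
          unfold mm
          rw [mul_sum, mul_sum, mul_sum, ← sum_add_distrib, ← sum_add_distrib]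
          apply sum_le_sum
          intro y _
          by_cases h1 : D.c y = d
          · rw [D.ind_self h1, D.ind_ne (b := a) (by rw [h1]; exact hda),
              D.ind_ne (b := D.c x) (by rw [h1]; exact hxd.symm), D.r_of h1]; simp
          · by_cases h2 : D.c y = a
            · rw [D.ind_self h2, D.ind_ne h1, D.ind_ne (b := D.c x) (by rw [h2]; exact hxa.symm),
                D.r_of h2]; simp
            · by_cases h3 : D.c y = D.c x
              · rw [D.ind_self h3, D.ind_ne h1, D.ind_ne h2, D.r_of h3]; simp
              · rw [D.ind_ne h3, D.ind_ne h2, D.ind_ne h1]; simp [D.r_nonneg]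
        rw [hd, val_self_ratio ha, hs1, ← hk] at this
        nlinarith
      · push Not at hex
        have : (p : ℤ) * D.k a l = ((d * a⁻¹).val : ℤ) * D.mm l d
            + ((a * a⁻¹).val : ℤ) * D.mm l a := by
          rw [D.pk]
          unfold mm
          rw [mul_sum, mul_sum, ← sum_add_distrib]
          apply sum_congr rfl
          intro y hy
          by_cases h1 : D.c y = d
          · rw [D.ind_self h1, D.ind_ne (b := a) (by rw [h1]; exact hda), D.r_of h1]; simp
          · by_cases h2 : D.c y = a
            · rw [D.ind_self h2, D.ind_ne h1, D.r_of h2]; simp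
            · by_cases h3 : D.c y = 0
              · rw [D.ind_ne h2, D.ind_ne h1, D.r_zero h3]; simp
              · exact absurd (hex y hy h3 h2) h1
        rw [hd, val_self_ratio ha, hs1, ← hk] at this
        linarith
    · have : D.mm l d < 2 * D.k a l := by
        by_contra! hcon
        nlinarith
      have : D.mm l d ≤ 3 * (D.k a l - 1) := by omega
      nlinarith
  have := sum_le_sum key
  rw [← mul_sum, sum_sub_distrib, ← mul_sum, hm2, hs, sum_sub_distrib, hm, sum_const,
    nsmul_eq_mul, D.card_thr] at this
  linarith

end PlaneCode

end

section
open Finset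
namespace PlaneCode
variable {p : ℕ} {X Λ : Type} [Fintype X] [Fintype Λ] [DecidableEq X] [DecidableEq Λ]
variable (D : PlaneCode p X Λ)
variable [hp : Fact p.Prime]

lemma prime_seven {q : ℕ} (hpp : q.Prime) (h7 : 7 ≤ q) (h10 : q ≤ 10) : q = 7 := by
  interval_cases q
  · rfl
  all_goals (exfalso; revert hpp; norm_num)

lemma seven_zero (h : p = 7) : (7 : ZMod p) = 0 := by
  have h1 := (ZMod.natCast_eq_zero_iff 7 p).2 (by rw [h])
  exact_mod_cast h1

lemma H_neg (hp7 : 7 ≤ p) (he : D.e ≤ 2) {b : ZMod p} (hb : b ≠ 0) (h : ∃ x, D.c x = b) :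
    ∃ x, D.c x = -b := by
  obtain ⟨P, hP⟩ := h
  apply D.exists_of_n
  have := D.n_neg_ge hp7 hP hb
  omega

lemma E_neg_add {b : ZMod p} (hb : b ≠ 0) (P : X) : D.E b + D.E (-b) = D.e := D.E_add hb P

lemma mu_aux (hp11 : 11 ≤ p) (he : D.e ≤ 2) {b d : ZMod p} (hb : b ≠ 0) (hd : d ≠ 0)
    (hHb : ∃ x, D.c x = b) (hHd : ∃ x, D.c x = d) {μ : ℕ} (hμ : (d * b⁻¹).val = μ)
    (h3 : 3 ≤ μ) (hμp : 2 * μ + 1 ≤ p)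
    (hmin : ∀ x y, x ≠ 0 → y ≠ 0 → (∃ z, D.c z = x) → (∃ z, D.c z = y) → (y * x⁻¹).val ≠ 1 →
      μ ≤ (y * x⁻¹).val) (hE : D.E (-b) ≤ 1) : False := by
  have hp7 : 7 ≤ p := by omega
  have hdb : d ≠ -b := by
    rintro rfl
    have := val_neg_ratio hb hb
    rw [val_self_ratio hb] at this
    omega
  have hHb' := D.H_neg hp7 he hb hHb
  have hHd' := D.H_neg hp7 he hd hHd
  obtain ⟨P, hP⟩ := hHb'
  obtain ⟨R, hR⟩ := hHd
  obtain ⟨R', hR'⟩ := hHd'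
  obtain ⟨P', hP'⟩ := hHb
  have hb' := neg_ne_zero.2 hb
  have hU := D.lemU hb hd hdb hR
  rw [hμ] at hU
  have hL := D.lemL (a := -b) (d := d) hb' (μ := μ) (by omega) (by exact_mod_cast hμp)
    (by
      have := val_neg_ratio hb hd
      rw [hμ] at this
      rw [inv_neg, mul_neg, ← neg_mul, this])
    (by
      intro x hx hxb
      rw [D.r_of rfl]
      have := hmin (-b) (D.c x) hb' hx ⟨P, hP⟩ ⟨x, rfl⟩ (by
        intro h1
        apply hxb
        have h2 : D.c x * (-b)⁻¹ = 1 := by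
          have := ZMod.natCast_zmod_val (D.c x * (-b)⁻¹)
          rw [h1] at this; rw [← this]; simp
        field_simp at h2
        linear_combination -h2)
      exact_mod_cast this) hP
  have hn := D.n_neg_ge hp7 hR' (neg_ne_zero.2 hd)
  rw [neg_neg] at hn
  have hEE := D.E_neg_add hb P
  have e1 := D.E_nonneg hb hP'
  have e2 := D.E_nonneg hb' hP
  rw [← hEE] at hn
  have he' : D.E b + D.E (-b) ≤ 2 := by omega
  generalize D.E b = g at *
  generalize D.E (-b) = a at *
  generalize D.n d = nd at *
  generalize D.n (-b) = N at *
  have h3' : (3 : ℤ) ≤ μ := by exact_mod_cast h3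
  have hp11' : (11 : ℤ) ≤ p := by exact_mod_cast hp11
  generalize (μ : ℤ) = m at *
  generalize (p : ℤ) = P at *
  obtain ⟨q, rfl⟩ : ∃ q, m = q + 1 := ⟨m - 1, by ring⟩
  have hq : 2 ≤ q := by omega
  have k1 : (q + 1 - 1) * (2 * P + 1 - (g + a) - 3 * a) ≤ N - 1 := by
    refine le_trans ?_ hL
    apply mul_le_mul_of_nonneg_left <;> omega
  have k2 : q * (q * (2 * P + 1 - g - 4 * a)) ≤ q * (N - 1) := by
    apply mul_le_mul_of_nonneg_left _ (by omega)
    calc _ = (q + 1 - 1) * (2 * P + 1 - (g + a) - 3 * a) := by ring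
      _ ≤ _ := k1
  have k3 : q * N ≤ (q + 1) * (P * q + g) := by
    calc q * N = (q + 1 - 1) * N := by ring
      _ ≤ _ := hU
      _ = _ := by ring
  have k4 : P * (q * (q - 1)) ≤ q * q * (g + 4 * a - 1) - q + (q + 1) * g := by nlinarith
  have k5 : 11 * (q * (q - 1)) ≤ P * (q * (q - 1)) :=
    mul_le_mul_of_nonneg_right hp11' (mul_nonneg (by omega) (by omega))
  have ha : a = 0 ∨ a = 1 := by omega
  have hg : g = 0 ∨ g = 1 ∨ g = 2 := by omega
  rcases ha with rfl | rfl <;> rcases hg with rfl | rfl | rfl <;> first | omega | nlinarith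

lemma exists_double (hp7 : 7 ≤ p) (he : D.e ≤ 2) {b d : ZMod p} (hb : b ≠ 0) (hd : d ≠ 0)
    (hHb : ∃ x, D.c x = b) (hHd : ∃ x, D.c x = d) (h1 : d ≠ b) (h2 : d ≠ -b) :
    ∃ b, b ≠ 0 ∧ (∃ x, D.c x = b) ∧ (∃ x, D.c x = 2 * b) := by
  classical
  let Pr : ℕ → Prop := fun m => m ≠ 1 ∧ ∃ x y, x ≠ 0 ∧ y ≠ 0 ∧ (∃ z, D.c z = x) ∧
    (∃ z, D.c z = y) ∧ (y * x⁻¹).val = m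
  have hval1 : ∀ x y : ZMod p, x ≠ 0 → (y * x⁻¹).val = 1 → y = x := by
    intro x y hx h
    have h2 : y * x⁻¹ = 1 := by
      have := ZMod.natCast_zmod_val (y * x⁻¹)
      rw [h] at this; rw [← this]; simp
    field_simp at h2
    exact h2
  have hPr1 : Pr (d * b⁻¹).val := ⟨fun h => h1 (hval1 b d hb h), b, d, hb, hd, hHb, hHd, rfl⟩
  have hPr2 : Pr ((-d) * b⁻¹).val := by
    refine ⟨fun h => h2 ?_, b, -d, hb, neg_ne_zero.2 hd, hHb, D.H_neg hp7 he hd hHd, rfl⟩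
    have := hval1 b (-d) hb h
    rw [← this]; simp
  have hex : ∃ m, Pr m := ⟨_, hPr1⟩
  have hsp := Nat.find_spec hex
  have hm1 := Nat.find_min' hex hPr1
  have hm2 := Nat.find_min' hex hPr2
  have hmin : ∀ x y, x ≠ 0 → y ≠ 0 → (∃ z, D.c z = x) → (∃ z, D.c z = y) → (y * x⁻¹).val ≠ 1 →
      Nat.find hex ≤ (y * x⁻¹).val := fun x y hx hy h3 h4 h5 =>
    Nat.find_min' hex ⟨h5, x, y, hx, hy, h3, h4, rfl⟩
  generalize Nat.find hex = μ at *
  obtain ⟨hμ1, x, y, hx, hy, hHx, hHy, hxy⟩ := hsp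
  have hneg := val_neg_ratio hb hd
  have hxy0 : (y * x⁻¹).val ≠ 0 := (ZMod.val_ne_zero _).2 (mul_ne_zero hy (inv_ne_zero hx))
  have hodd : p % 2 = 1 := by
    rcases hp.out.eq_two_or_odd with h | h <;> omega
  have hμp : 2 * μ + 1 ≤ p := by omega
  have hyx : y = (μ : ZMod p) * x := by
    have := ZMod.natCast_zmod_val (y * x⁻¹)
    rw [hxy] at this; rw [this]; field_simp
  by_cases h3 : μ = 2
  · refine ⟨x, hx, hHx, ?_⟩
    rw [h3] at hyx
    rw [hyx] at hHy; simpa using hHy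
  exfalso
  have h3' : 3 ≤ μ := by omega
  by_cases hp11 : 11 ≤ p
  · obtain ⟨P, hP⟩ := hHx
    have hEE := D.E_neg_add hx P
    by_cases hE : D.E (-x) ≤ 1
    · exact D.mu_aux hp11 he hx hy ⟨P, hP⟩ hHy hxy h3' hμp hmin hE
    · refine D.mu_aux hp11 he (neg_ne_zero.2 hx) (neg_ne_zero.2 hy) (D.H_neg hp7 he hx ⟨P, hP⟩)
        (D.H_neg hp7 he hy hHy) (μ := μ) ?_ h3' hμp hmin ?_
      · rw [← hxy]; congr 1; field_simp
      · rw [neg_neg]; omega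
  · have hp7' : p = 7 := by
      exact prime_seven hp.out hp7 (by omega)
    have hμ3 : μ = 3 := by omega
    have h70 : (7 : ZMod p) = 0 := by
      exact seven_zero hp7'
    have hxy2 : (-x) * y⁻¹ = 2 := by
      field_simp
      rw [hyx, hμ3]; push_cast; linear_combination -x * h70
    have hv : ((-x) * y⁻¹).val = 2 := by
      rw [hxy2]
      have := ZMod.val_natCast_of_lt (show 2 < p by omega)
      exact_mod_cast this
    have := hmin y (-x) hy (neg_ne_zero.2 hx) hHy (D.H_neg hp7 he hx hHx) (by omega)
    omega

lemma val_two (hp7 : 7 ≤ p) {b : ZMod p} (hb : b ≠ 0) : ((2 * b) * b⁻¹).val = 2 := by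
  rw [mul_assoc, mul_inv_cancel₀ hb, mul_one]
  have := ZMod.val_natCast_of_lt (show 2 < p by omega)
  exact_mod_cast this

lemma two_ne_neg (hp7 : 7 ≤ p) {b : ZMod p} (hb : b ≠ 0) : 2 * b ≠ -b := by
  intro h
  have : ((3 : ℕ) : ZMod p) * b = 0 := by push_cast; linear_combination h
  exact (mul_ne_zero (small_ne hp7 3 (by norm_num) (by norm_num)) hb) this

lemma two_ne_zero' (hp7 : 7 ≤ p) {b : ZMod p} (hb : b ≠ 0) : 2 * b ≠ 0 := by
  have := (mul_ne_zero (small_ne hp7 2 (by norm_num) (by norm_num)) hb)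
  exact_mod_cast this

lemma U2 (hp7 : 7 ≤ p) {b : ZMod p} (hb : b ≠ 0) (h : ∃ x, D.c x = 2 * b) :
    D.n (-b) ≤ 2 * p + 2 * D.E b := by
  obtain ⟨R, hR⟩ := h
  have := D.lemU hb (two_ne_zero' hp7 hb) (two_ne_neg hp7 hb) hR
  rw [val_two hp7 hb] at this
  push_cast at this
  linarith

lemma full_step (hp7 : 7 ≤ p) (he : D.e ≤ 2) {b : ZMod p} (hb : b ≠ 0)
    (hHb : ∃ x, D.c x = b) (h2b : ∃ x, D.c x = 2 * b) (hE : D.E b ≤ 1)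
    {d : ZMod p} (hd : d ≠ 0) (hHd : ∃ x, D.c x = d) (h1 : d ≠ b) (h2 : d ≠ -b) :
    ∃ x, D.c x = b + d := by
  obtain ⟨P, hP⟩ := hHb
  have hU := D.U2 hp7 hb h2b
  have hf := D.sum_f hp7 hP hb
  have hbd : b + d ≠ 0 := fun h => h2 (by linear_combination h)
  suffices h : ∃ x, D.c x = -b - d by
    have := D.H_neg hp7 he (b := -b - d) (fun h => hbd (by linear_combination -h)) h
    convert this using 3; ring
  by_contra hcon
  have key : ∀ l ∈ D.thr P, D.mm l d ≤ 3 * D.f b l := by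
    intro l hl
    have hl := D.mem_thr.1 hl
    have hsz := D.sz_ge2 hl (hP ▸ hb)
    have hfg := D.f_ge hp7 hl hP hb
    rcases hsz.eq_or_lt with hs | hs
    · rw [D.two_line hl hP hb hs.symm d hd, if_neg h1, if_neg h2]; omega
    · by_cases hs3 : D.sz l = 3
      · obtain ⟨y, hy, hy2, hm⟩ := D.three_line hl hP hb hs3
        have hmd := hm d hd
        have hmd2 := hm (-b - d) (fun h => hbd (by linear_combination -h))
        have : D.mm l (-b - d) < 1 := by
          by_contra! hc
          obtain ⟨x, _, hx⟩ := D.exists_of_mm hc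
          exact hcon ⟨x, hx⟩
        have e1 : (-b - d = y) ↔ (d = -b - y) :=
          ⟨fun h => by linear_combination -h, fun h => by linear_combination -h⟩
        have e2 : (-b - d = -b - y) ↔ (d = y) :=
          ⟨fun h => by linear_combination -h, fun h => by linear_combination -h⟩
        rw [if_neg h1] at hmd
        simp only [e1, e2] at hmd2
        have : (0 : ℤ) ≤ if -b - d = b then 1 else 0 := by split_ifs <;> simp
        omega
      · have g1 := D.mm_add_le_sz (l := l) hb hd (Ne.symm h1)
        have g2 := D.mm_pos hl hP
        omega
  have hs := sum_le_sum key
  rw [← mul_sum, hf, D.sum_mm, D.ind_ne (by rw [hP]; exact Ne.symm h1)] at hs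
  obtain ⟨R, hR⟩ := D.H_neg hp7 he hd hHd
  have hn := D.n_neg_ge hp7 hR (neg_ne_zero.2 hd)
  rw [neg_neg] at hn
  omega

lemma full (hp7 : 7 ≤ p) (he : D.e ≤ 2) {b : ZMod p} (hb : b ≠ 0)
    (hHb : ∃ x, D.c x = b) (h2b : ∃ x, D.c x = 2 * b) :
    ∀ x : ZMod p, x ≠ 0 → ∃ P, D.c P = x := by
  wlog hE : D.E b ≤ 1 generalizing b
  · obtain ⟨P, hP⟩ := hHb
    have hEE := D.E_neg_add hb P
    refine this (neg_ne_zero.2 hb) (D.H_neg hp7 he hb ⟨P, hP⟩) ?_ (by omega)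
    have := D.H_neg hp7 he (two_ne_zero' hp7 hb) h2b
    convert this using 3; ring
  have hj : ∀ j : ℕ, 2 ≤ j → j < p → ∃ P, D.c P = (j : ZMod p) * b := by
    intro j hj
    induction j, hj using Nat.le_induction with
    | base => intro _; exact_mod_cast h2b
    | succ j hj ih =>
      intro hjp
      have hne : ∀ i : ℕ, 0 < i → i < p → (i : ZMod p) ≠ 0 := by
        intro i h0 h1 h
        rw [ZMod.natCast_eq_zero_iff] at h
        have := Nat.le_of_dvd h0 h
        omega
      have := D.full_step hp7 he hb hHb h2b hE (d := (j : ZMod p) * b)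
        (mul_ne_zero (hne j (by omega) (by omega)) hb) (ih (by omega))
        (by
          intro h
          apply mul_ne_zero (hne (j - 1) (by omega) (by omega)) hb
          rw [Nat.cast_sub (by omega)]; push_cast; linear_combination h)
        (by
          intro h
          apply mul_ne_zero (hne (j + 1) (by omega) (by omega)) hb
          push_cast; linear_combination h)
      convert this using 3; push_cast; ring
  intro x hx
  have hv := ZMod.val_lt (x * b⁻¹)
  have hxv : x = ((x * b⁻¹).val : ZMod p) * b := by
    rw [ZMod.natCast_zmod_val]; field_simp
  have h0 : (x * b⁻¹).val ≠ 0 := (ZMod.val_ne_zero _).2 (mul_ne_zero hx (inv_ne_zero hb))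
  by_cases h1 : (x * b⁻¹).val = 1
  · rw [h1] at hxv
    rw [hxv]; simpa using hHb
  · rw [hxv]; exact hj _ (by omega) hv

end PlaneCode

end

section
open Finset
namespace PlaneCode
variable {p : ℕ} {X Λ : Type} [Fintype X] [Fintype Λ] [DecidableEq X] [DecidableEq Λ]
variable (D : PlaneCode p X Λ)
variable [hp : Fact p.Prime]

lemma sum_n : ∑ d ∈ (univ : Finset (ZMod p)).erase 0, D.n d = D.w := by
  unfold n w
  rw [sum_comm]
  apply sum_congr rfl
  intro x _
  unfold ind sup
  split_ifs with h
  · apply sum_eq_zero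
    intro d hd
    rw [if_neg]; rw [h]; exact (ne_of_mem_erase hd).symm
  · rw [sum_eq_single_of_mem (D.c x) (mem_erase.2 ⟨h, mem_univ _⟩)]
    · simp
    · intro d _ hd; rw [if_neg hd.symm]

lemma sum_n_weighted (P : X) : ∑ d : ZMod p, d * ((D.n d : ℤ) : ZMod p) = 0 := by
  have h1 : ∑ d : ZMod p, d * ((D.n d : ℤ) : ZMod p) = ∑ x, D.c x := by
    unfold n ind
    push_cast
    simp_rw [mul_sum]
    rw [sum_comm]
    apply sum_congr rfl
    intro x _
    simp
  rw [h1]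
  have h2 : ∑ l ∈ D.thr P, ∑ x ∈ D.pts l, D.c x = 0 := sum_eq_zero fun l _ => D.zero l
  -- lift to integers
  have h3 := D.T_dvd 1 P
  rw [← ZMod.intCast_zmod_eq_zero_iff_dvd _ p] at h3
  unfold T r at h3
  push_cast at h3
  simpa using h3

lemma card_nz : (#((univ : Finset (ZMod p)).erase 0) : ℤ) = p - 1 := by
  rw [card_erase_of_mem (mem_univ _), card_univ, ZMod.card]
  have := hp.out.pos
  push_cast [this]; ring

lemma sum_nz_neg (g : ZMod p → ℤ) : ∑ d ∈ (univ : Finset (ZMod p)).erase 0, g (-d)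
    = ∑ d ∈ (univ : Finset (ZMod p)).erase 0, g d := by
  apply sum_nbij' (fun x => -x) (fun x => -x) <;> simp

lemma smul_ne (hp7 : 7 ≤ p) (m : ℕ) (h0 : 0 < m) (h1 : m < 7) {b : ZMod p} (hb : b ≠ 0) :
    (m : ZMod p) * b ≠ 0 := mul_ne_zero (small_ne hp7 m h0 h1) hb

lemma n_eq0 (hp7 : 7 ≤ p) {b : ZMod p} (hb : b ≠ 0) {P : X} (hP : D.c P = b)
    (hn : D.n (-b) = 2 * p + 1 - D.e) : D.n b = D.n (-2 * b) + 1 := by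
  have h := D.sym0 hp7 hP hb hn hb (ne_neg hp7 hb)
  rw [if_pos rfl, if_neg] at h
  · rw [show -2 * b = -b - b by ring]; linarith
  · intro h
    exact smul_ne hp7 3 (by norm_num) (by norm_num) hb (by push_cast; linear_combination -h)

lemma n_even (hp7 : 7 ≤ p) {b : ZMod p} (hb : b ≠ 0) {R : X} (hR : D.c R = -2 * b)
    (hn : D.n (-b) = 2 * p + 1 - D.e) : 2 ∣ D.n b := by
  have hne : b ≠ -2 * b := fun h =>
    smul_ne hp7 3 (by norm_num) (by norm_num) hb (by push_cast; linear_combination h)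
  have hs := D.sum_mm b R
  rw [D.ind_ne (by rw [hR]; exact hne.symm), mul_zero, add_zero] at hs
  rw [← hs]
  apply dvd_sum
  intro l hl
  have hl := D.mem_thr.1 hl
  have h0 := D.mm_nonneg l b
  rcases h0.eq_or_lt with h0 | h0
  · rw [← h0]; simp
  obtain ⟨P, hPl, hP⟩ := D.exists_of_mm (show 1 ≤ D.mm l b by omega)
  have hsz := D.good0 hp7 hP hb hn l hPl
  have hsz2 := D.sz_ge2 hPl (hP ▸ hb)
  have h20 : -2 * b ≠ 0 := fun h => two_ne_zero' hp7 hb (by linear_combination -h)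
  have hmR := D.mm_pos hl hR
  have h2b : -2 * b ≠ -b := fun h => hb (by linear_combination -h)
  rcases hsz2.eq_or_lt with h2 | h2
  · rw [D.two_line hPl hP hb h2.symm _ h20, if_neg hne.symm, if_neg h2b] at hmR
    omega
  · obtain ⟨y, hy, hy2, hm⟩ := D.three_line hPl hP hb (by omega)
    rw [hm _ h20, if_neg hne.symm] at hmR
    rw [hm b hb, if_pos rfl]
    by_cases e1 : -2 * b = y
    · rw [← e1, if_neg hne, if_pos (by ring)]; norm_num
    · rw [if_neg e1] at hmR
      have e2 : -2 * b = -b - y := by by_contra e2; rw [if_neg e2] at hmR; omega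
      have e3 : y = b := by linear_combination e2
      rw [e3, if_pos rfl, if_neg (fun h => hne (by linear_combination h))]; norm_num

lemma e1_false (hp7 : 7 ≤ p) (hF : ∀ x : ZMod p, x ≠ 0 → ∃ P, D.c P = x) (he : D.e ≤ 1) :
    False := by
  have hge : ∀ x : ZMod p, x ≠ 0 → 2 * p + 1 - D.e ≤ D.n x := by
    intro x hx
    obtain ⟨P, hP⟩ := hF (-x) (neg_ne_zero.2 hx)
    have := D.n_neg_ge hp7 hP (neg_ne_zero.2 hx)
    rwa [neg_neg] at this
  have hU : ∀ b : ZMod p, b ≠ 0 → D.n (-b) ≤ 2 * p + 2 * D.E b := fun b hb =>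
    D.U2 hp7 hb (hF _ (two_ne_zero' hp7 hb))
  have hEE : ∀ b : ZMod p, b ≠ 0 → D.E b + D.E (-b) = D.e ∧ 0 ≤ D.E b ∧ 0 ≤ D.E (-b) := by
    intro b hb
    obtain ⟨P, hP⟩ := hF b hb
    obtain ⟨R, hR⟩ := hF (-b) (neg_ne_zero.2 hb)
    exact ⟨D.E_neg_add hb P, D.E_nonneg hb hP, D.E_nonneg (neg_ne_zero.2 hb) hR⟩
  have key0 : ∀ b : ZMod p, b ≠ 0 → D.E b = 0 → D.e = 1 ∧ 2 * p + 2 ≤ D.n b := by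
    intro b hb h0
    have h1 := hU b hb
    have h2 := hge (-b) (neg_ne_zero.2 hb)
    have hn : D.n (-b) = 2 * p + 1 - D.e := by omega
    obtain ⟨P, hP⟩ := hF b hb
    have h20 : -2 * b ≠ 0 := fun h => two_ne_zero' hp7 hb (by linear_combination -h)
    obtain ⟨R, hR⟩ := hF _ h20
    have h3 := D.n_eq0 hp7 hb hP hn
    have h4 := D.n_even hp7 hb hR hn
    have h5 := hge _ h20
    omega
  have key : ∀ b ∈ (univ : Finset (ZMod p)).erase 0, (4 * p + 2 : ℤ) ≤ D.n b + D.n (-b) := by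
    intro b hb
    have hb := ne_of_mem_erase hb
    obtain ⟨h1, h2, h3⟩ := hEE b hb
    have g1 := hge b hb
    have g2 := hge (-b) (neg_ne_zero.2 hb)
    by_cases h : D.E b = 0
    · have := key0 b hb h; omega
    · have := key0 (-b) (neg_ne_zero.2 hb) (by omega); omega
  have hs := sum_le_sum key
  rw [sum_const, nsmul_eq_mul, card_nz, sum_add_distrib, sum_nz_neg (fun d => D.n d), D.sum_n] at hs
  have : D.w = D.e + 2 * (p ^ 2 - p + 1) := by unfold e; ring
  have hp7' : (7 : ℤ) ≤ p := by exact_mod_cast hp7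
  nlinarith

/-- the normalised counts -/
def v (x : ZMod p) : ℤ := D.n x - 2 * p

lemma sum_v (he : D.e = 2) : ∑ d ∈ (univ : Finset (ZMod p)).erase 0, D.v d = 4 := by
  unfold v
  rw [sum_sub_distrib, D.sum_n, sum_const, nsmul_eq_mul, card_nz]
  unfold e at he
  linarith

lemma v_ge (hp7 : 7 ≤ p) (hF : ∀ x : ZMod p, x ≠ 0 → ∃ P, D.c P = x) (he : D.e = 2) :
    ∀ x : ZMod p, x ≠ 0 → -1 ≤ D.v x := by
  intro x hx
  obtain ⟨P, hP⟩ := hF (-x) (neg_ne_zero.2 hx)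
  have := D.n_neg_ge hp7 hP (neg_ne_zero.2 hx)
  rw [neg_neg] at this
  unfold v; omega

lemma v_K (hp7 : 7 ≤ p) (hF : ∀ x : ZMod p, x ≠ 0 → ∃ P, D.c P = x) (he : D.e = 2) :
    ∀ b : ZMod p, b ≠ 0 → D.v (-b) = -1 → 2 ∣ D.v b ∧ D.v b = 1 + D.v (-2 * b) ∧
      ∀ x, x ≠ 0 → x ≠ b → x ≠ -b → x ≠ -2 * b → D.v x = D.v (-b - x) := by
  intro b hb hv
  have hn : D.n (-b) = 2 * p + 1 - D.e := by unfold v at hv; omega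
  obtain ⟨P, hP⟩ := hF b hb
  have h20 : -2 * b ≠ 0 := fun h => two_ne_zero' hp7 hb (by linear_combination -h)
  obtain ⟨R, hR⟩ := hF _ h20
  have h3 := D.n_eq0 hp7 hb hP hn
  have h4 := D.n_even hp7 hb hR hn
  refine ⟨by unfold v; omega, by unfold v; omega, fun x h0 h1 h2 h3 => ?_⟩
  have := D.sym0 hp7 hP hb hn h0 h2
  rw [if_neg h1, if_neg] at this
  · unfold v; omega
  · intro h; exact h3 (by linear_combination -h)

lemma K2_eq (hp7 : 7 ≤ p) {v : ZMod p → ℤ}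
    (hK : ∀ b : ZMod p, b ≠ 0 → v (-b) = -1 → 2 ∣ v b ∧ v b = 1 + v (-2 * b) ∧
      ∀ x, x ≠ 0 → x ≠ b → x ≠ -b → x ≠ -2 * b → v x = v (-b - x))
    {b d : ZMod p} (hb : b ≠ 0) (hd : d ≠ 0) (hbd : b ≠ d) (vb : v (-b) = -1)
    (vd : v (-d) = -1) : v b = v d ∧ (d = 2 * b ∨ b = 2 * d) := by
  obtain ⟨b1, b2, b3⟩ := hK b hb vb
  obtain ⟨d1, d2, d3⟩ := hK d hd vd
  have n1 : d ≠ -b := by rintro rfl; rw [neg_neg] at vd; omega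
  have n2 : b ≠ -2 * d := by intro h; rw [← h] at d2; omega
  have n3 : d ≠ -2 * b := by intro h; rw [← h] at b2; omega
  have e1 := b3 d hd hbd.symm n1 n3
  have e2 := d3 b hb hbd (fun h => n1 (by linear_combination h)) n2
  refine ⟨by rw [e1, e2]; congr 1; ring, ?_⟩
  by_contra! hcon
  obtain ⟨c1, c2⟩ := hcon
  have e3 := b3 (-d) (neg_ne_zero.2 hd) (fun h => n1 (by linear_combination -h))
    (fun h => hbd (by linear_combination h)) (fun h => c1 (by linear_combination -h))
  have e4 := d3 (-b) (neg_ne_zero.2 hb) (fun h => n1 (by linear_combination -h))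
    (fun h => hbd (by linear_combination -h)) (fun h => c2 (by linear_combination -h))
  have e5 := hK (b - d) (fun h => hbd (by linear_combination h))
    (by rw [← vd, e3]; congr 1; ring)
  have : v (b - d) = -1 := by rw [← vb, e4]; congr 1; ring
  omega

lemma K2_aux (hp7 : 7 ≤ p) {v : ZMod p → ℤ}
    (hK : ∀ b : ZMod p, b ≠ 0 → v (-b) = -1 → 2 ∣ v b ∧ v b = 1 + v (-2 * b) ∧
      ∀ x, x ≠ 0 → x ≠ b → x ≠ -b → x ≠ -2 * b → v x = v (-b - x))
    (hs : ∑ d ∈ (univ : Finset (ZMod p)).erase 0, v d = 4)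
    {b : ZMod p} (hb : b ≠ 0) (vb : v (-b) = -1)
    (vd : v (-(2 * b)) = -1) : False := by
  have hd := two_ne_zero' hp7 hb
  have hbd : b ≠ 2 * b := fun h => hb (by linear_combination -h)
  obtain ⟨q1, _⟩ := K2_eq hp7 hK hb hd hbd vb vd
  obtain ⟨b1, b2, b3⟩ := hK b hb vb
  obtain ⟨d1, d2, d3⟩ := hK _ hd vd
  rw [show -2 * b = -(2 * b) by ring, vd] at b2
  rw [show -2 * (2 * b) = -(4 * b) by ring] at d2
  have v4 : v (-(4 * b)) = -1 := by omega
  have h40 : 4 * b ≠ 0 := by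
    have := smul_ne hp7 4 (by norm_num) (by norm_num) hb
    exact_mod_cast this
  have h4b : b ≠ 4 * b := fun h =>
    smul_ne hp7 3 (by norm_num) (by norm_num) hb (by push_cast; linear_combination -h)
  obtain ⟨q2, q3⟩ := K2_eq hp7 hK hb h40 h4b vb v4
  have h7 : (7 : ZMod p) * b = 0 := by
    rcases q3 with h | h
    · exfalso; exact hd (by linear_combination h)
    · linear_combination -h
  have h70 : ((7 : ℕ) : ZMod p) = 0 := by
    rcases mul_eq_zero.1 h7 with h | h
    · exact_mod_cast h
    · exact absurd h hb
  rw [ZMod.natCast_eq_zero_iff] at h70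
  have hp7' : p = 7 := by have := Nat.le_of_dvd (by norm_num) h70; omega
  have : ∑ d ∈ (univ : Finset (ZMod p)).erase 0, v d ≤ 0 := by
    apply sum_nonpos
    intro x hx
    have hx := ne_of_mem_erase hx
    have hv := ZMod.val_lt (x * b⁻¹)
    have hxv : x = ((x * b⁻¹).val : ZMod p) * b := by
      rw [ZMod.natCast_zmod_val]; field_simp
    have h0 : (x * b⁻¹).val ≠ 0 := (ZMod.val_ne_zero _).2 (mul_ne_zero hx (inv_ne_zero hb))
    have hv7 : (x * b⁻¹).val < 7 := by omega
    generalize (x * b⁻¹).val = j at *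
    rw [hxv]
    interval_cases j
    · omega
    · rw [show ((1 : ℕ) : ZMod p) * b = b by push_cast; ring]; omega
    · rw [show ((2 : ℕ) : ZMod p) * b = 2 * b by push_cast; ring]; omega
    · rw [show ((3 : ℕ) : ZMod p) * b = -(4 * b) by push_cast; linear_combination h7]; omega
    · rw [show ((4 : ℕ) : ZMod p) * b = 4 * b by push_cast; ring]; omega
    · rw [show ((5 : ℕ) : ZMod p) * b = -(2 * b) by push_cast; linear_combination h7]; omega
    · rw [show ((6 : ℕ) : ZMod p) * b = -b by push_cast; linear_combination h7]; omega
  omega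

lemma K2_false (hp7 : 7 ≤ p) {v : ZMod p → ℤ}
    (hK : ∀ b : ZMod p, b ≠ 0 → v (-b) = -1 → 2 ∣ v b ∧ v b = 1 + v (-2 * b) ∧
      ∀ x, x ≠ 0 → x ≠ b → x ≠ -b → x ≠ -2 * b → v x = v (-b - x))
    (hs : ∑ d ∈ (univ : Finset (ZMod p)).erase 0, v d = 4)
    {b d : ZMod p} (hb : b ≠ 0) (hd : d ≠ 0) (hbd : b ≠ d) (vb : v (-b) = -1)
    (vd : v (-d) = -1) : False := by
  obtain ⟨_, h | h⟩ := K2_eq hp7 hK hb hd hbd vb vd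
  · exact K2_aux hp7 hK hs hb vb (h ▸ vd)
  · exact K2_aux hp7 hK hs hd vd (h ▸ vb)

end PlaneCode

end

section
open Finset
namespace PlaneCode
variable {p : ℕ} {X Λ : Type} [Fintype X] [Fintype Λ] [DecidableEq X] [DecidableEq Λ]
variable (D : PlaneCode p X Λ)
variable [hp : Fact p.Prime]

lemma v_G (hp7 : 7 ≤ p) (he : D.e = 2) {b : ZMod p} (hb : b ≠ 0) (hv : D.v (-b) = 0)
    {P : X} (hP : D.c P = b) : ∃ Q, P ∈ D.pts Q ∧ D.sz Q = 4 ∧ D.mm Q (-b) = 0 ∧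
      (∀ l, P ∈ D.pts l → l ≠ Q → D.sz l ≤ 3) ∧
      ∀ x, x ≠ 0 → x ≠ -b → D.v x - D.mm Q x = D.v (-b - x) - D.mm Q (-b - x) := by
  obtain ⟨Q, h1, h2, h3, h4⟩ := D.good1 hp7 hP hb (by unfold v at hv; omega)
  refine ⟨Q, h1, h2, h3, h4, fun x hx hx2 => ?_⟩
  have := D.sym1 hP hb h1 h4 hx hx2
  unfold v; omega

lemma v_G' (hp7 : 7 ≤ p) (he : D.e = 2) {b : ZMod p} (hb : b ≠ 0) (hv : D.v (-b) = 0)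
    {P : X} (hP : D.c P = b) {Q : Λ} (hPQ : P ∈ D.pts Q) (hQ : 3 < D.sz Q) :
      D.sz Q = 4 ∧ D.mm Q (-b) = 0 ∧
      (∀ l, P ∈ D.pts l → l ≠ Q → D.sz l ≤ 3) ∧
      ∀ x, x ≠ 0 → x ≠ -b → D.v x - D.mm Q x = D.v (-b - x) - D.mm Q (-b - x) := by
  obtain ⟨Q', h1, h2, h3, h4, h5⟩ := D.v_G hp7 he hb hv hP
  have : Q = Q' := by
    by_contra hne
    have := h4 Q hPQ hne
    omega
  subst this
  exact ⟨h2, h3, h4, h5⟩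

lemma sub_sum {v : ZMod p → ℤ} (s : Finset (ZMod p)) (h0 : 0 ∉ s)
    (h : ∀ x, x ≠ 0 → x ∉ s → 0 ≤ v x) :
    ∑ x ∈ s, v x ≤ ∑ x ∈ (univ : Finset (ZMod p)).erase 0, v x := by
  apply sum_le_sum_of_subset_of_nonneg
  · intro x hx
    exact mem_erase.2 ⟨fun h => h0 (h ▸ hx), mem_univ _⟩
  · intro x hx hxs
    exact h x (ne_of_mem_erase hx) hxs

lemma K1_false (hp7 : 7 ≤ p) (hF : ∀ x : ZMod p, x ≠ 0 → ∃ P, D.c P = x) (he : D.e = 2)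
    {b : ZMod p} (hb : b ≠ 0) (vb : D.v (-b) = -1) (hun : ∀ x, x ≠ 0 → x ≠ -b → 0 ≤ D.v x) :
    False := by
  have hs := D.sum_v he
  obtain ⟨b1, b2, b3⟩ := D.v_K hp7 hF he b hb vb
  have h20 : -2 * b ≠ 0 := fun h => two_ne_zero' hp7 hb (by linear_combination -h)
  have h21 : -2 * b ≠ -b := fun h => hb (by linear_combination -h)
  have h22 : -2 * b ≠ b := fun h =>
    smul_ne hp7 3 (by norm_num) (by norm_num) hb (by push_cast; linear_combination -h)
  have hv2 := hun _ h20 h21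
  have hvb : 2 ≤ D.v b := by omega
  have hbb := ne_neg hp7 hb
  -- zeros
  have hz : ∀ d, d ≠ 0 → D.v (-d) = 0 → d = -2 * b := by
    intro d hd hvd
    have hdb : d ≠ b := by rintro rfl; omega
    have hdb' : d ≠ -b := by rintro rfl; rw [neg_neg] at hvd; omega
    obtain ⟨P, hP⟩ := hF d hd
    obtain ⟨Q, hPQ, hQ4, hQd, hQs, hQv⟩ := D.v_G hp7 he hd hvd hP
    have hmb : D.mm Q b = 0 := by
      by_contra hne
      have := D.mm_nonneg Q b
      obtain ⟨R, hRQ, hR⟩ := D.exists_of_mm (show 1 ≤ D.mm Q b by omega)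
      have := D.good0 hp7 hR hb (by unfold v at vb; omega) Q hRQ
      omega
    have h1 := hQv b hb (fun h => hdb' (by linear_combination h))
    have hm0 := D.mm_nonneg Q (-d - b)
    have hy0 : -d - b ≠ 0 := fun h => hdb' (by linear_combination -h)
    obtain ⟨y, hy⟩ : ∃ y, y = -d - b := ⟨_, rfl⟩
    rw [← hy] at h1 hm0 hy0
    by_contra hcon
    have hyb : y ≠ b := fun h => hcon (by rw [h] at hy; linear_combination hy)
    have hyb' : y ≠ -b := by rintro rfl; omega
    have hyb2 : y ≠ -2 * b := by rintro rfl; omega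
    have h2 := b3 y hy0 hyb hyb' hyb2
    rw [show -b - y = d by rw [hy]; ring] at h2
    by_cases hdy : d = y
    · have hm := D.mm_pos hPQ hP
      rw [hdy] at hm
      have := sub_sum (v := D.v) {b, -b, -2 * b, y} (by
          simp only [mem_insert, mem_singleton]
          have := hb.symm; have := hy0.symm; have := (neg_ne_zero.2 hb).symm
          have := h20.symm; tauto) (by
          intro x hx hxs
          apply hun x hx
          rintro rfl; simp at hxs)
      rw [sum_insert (by simp only [mem_insert, mem_singleton]; tauto),
        sum_insert (by simp only [mem_insert, mem_singleton]; tauto),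
        sum_insert (by simp only [mem_insert, mem_singleton]; tauto), sum_singleton] at this
      omega
    · have hd2 : d ≠ -2 * b := fun h => hyb (by rw [hy, h]; ring)
      have := sub_sum (v := D.v) {b, -b, -2 * b, y, d} (by
          simp only [mem_insert, mem_singleton]
          have := hb.symm; have := hy0.symm; have := hd.symm; have := (neg_ne_zero.2 hb).symm
          have := h20.symm; tauto) (by
          intro x hx hxs
          apply hun x hx
          rintro rfl; simp at hxs)
      rw [sum_insert (by simp only [mem_insert, mem_singleton]; tauto),
        sum_insert (by simp only [mem_insert, mem_singleton]; tauto),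
        sum_insert (by simp only [mem_insert, mem_singleton]; tauto),
        sum_insert (by simp only [mem_insert, mem_singleton]; tauto), sum_singleton] at this
      omega
  have hb2 := two_ne_zero' hp7 hb
  have hp2 := b3 (2 * b) hb2 (fun h => hb (by linear_combination h)) (two_ne_neg hp7 hb) (fun h =>
    smul_ne hp7 4 (by norm_num) (by norm_num) hb (by push_cast; linear_combination h))
  have hnz : D.v (2 * b) ≠ 0 := by
    intro h
    have := hz (3 * b) (by
      have := smul_ne hp7 3 (by norm_num) (by norm_num) hb
      exact_mod_cast this) (by rw [← h, hp2]; congr 1; ring)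
    exact smul_ne hp7 5 (by norm_num) (by norm_num) hb (by push_cast; linear_combination this)
  have hpos : ∀ x, x ≠ 0 → x ≠ -b → 1 ≤ D.v x := by
    intro x hx hxb
    have h1 := hun x hx hxb
    by_contra hc
    have h2 := hz (-x) (neg_ne_zero.2 hx) (by rw [neg_neg]; omega)
    have h3 : x = 2 * b := by linear_combination -h2
    rw [h3] at hc h1; omega
  have := sub_sum (v := fun x => D.v x - 1) {b, -b} (by
      simp only [mem_insert, mem_singleton]
      have := hb.symm; have := (neg_ne_zero.2 hb).symm; tauto) (by
      intro x hx hxs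
      have := hpos x hx (by rintro rfl; simp at hxs)
      omega)
  rw [sum_insert (by simpa using hbb), sum_singleton, sum_sub_distrib, hs, sum_const, nsmul_eq_mul,
    card_nz] at this
  omega

/-- two good values on a four point line -/
lemma two_good (hp7 : 7 ≤ p) (he : D.e = 2) {Q : Λ} (hQ : D.sz Q = 4) {a d : ZMod p}
    (ha : a ≠ 0) (hd : d ≠ 0) (had : a ≠ d) (va : D.v (-a) = 0) (vd : D.v (-d) = 0)
    (ma : 1 ≤ D.mm Q a) (md : 1 ≤ D.mm Q d) : ∀ x, x ≠ 0 → D.v x = D.mm Q x := by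
  let W : ZMod p → ℤ := fun x => if x = 0 then 0 else D.v x - D.mm Q x
  have key : ∀ a : ZMod p, a ≠ 0 → D.v (-a) = 0 → 1 ≤ D.mm Q a → ∀ x, W x = W (-a - x) := by
    intro a ha va ma x
    obtain ⟨P, hPQ, hP⟩ := D.exists_of_mm ma
    obtain ⟨_, h2, _, h4⟩ := D.v_G' hp7 he ha va hP hPQ (by omega)
    by_cases hx : x = 0
    · subst hx
      simp only [W, if_true, sub_zero, if_neg (neg_ne_zero.2 ha)]; omega
    · by_cases hx2 : x = -a
      · subst hx2
        simp only [W, sub_self, if_true, if_neg (neg_ne_zero.2 ha)]; omega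
      · simp only [W, if_neg hx]
        rw [if_neg (fun h => hx2 (by linear_combination -h))]
        exact h4 x hx hx2
  have k1 := key a ha va ma
  have k2 := key d hd vd md
  have k3 : ∀ x, W x = W (x + (d - a)) := by
    intro x
    rw [k2 x, k1 (-d - x)]; congr 1; ring
  have k4 : ∀ (j : ℕ), W (j * (d - a)) = 0 := by
    intro j
    induction j with
    | zero => simp [W]
    | succ j ih => rw [← ih, k3 (j * (d - a))]; congr 1; push_cast; ring
  intro x hx
  have hda : d - a ≠ 0 := sub_ne_zero.2 had.symm
  have := k4 (x * (d - a)⁻¹).val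
  rw [ZMod.natCast_zmod_val, mul_assoc, inv_mul_cancel₀ hda, mul_one] at this
  simp only [W, if_neg hx] at this
  omega

lemma four_line {l : Λ} {P : X} {b : ZMod p} (hP : P ∈ D.pts l) (hc : D.c P = b) (hb : b ≠ 0)
    (h : D.sz l = 4) :
    ∃ y z, y ≠ 0 ∧ z ≠ 0 ∧ -b - y - z ≠ 0 ∧ ∀ x, x ≠ 0 → D.mm l x =
      (if x = b then 1 else 0) + (if x = y then 1 else 0) + (if x = z then 1 else 0)
      + (if x = -b - y - z then 1 else 0) := by
  have hm : P ∈ D.spt l := D.mem_spt.2 ⟨hP, hc ▸ hb⟩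
  have hz := D.zero_spt l
  rw [sz_eq] at h
  have h1 : #((D.spt l).erase P) = 3 := by rw [card_erase_of_mem hm]; omega
  obtain ⟨Q, R, S, hQR, hQS, hRS, hQ⟩ := card_eq_three.1 h1
  have h2 : D.spt l = insert P {Q, R, S} := by rw [← hQ, insert_erase hm]
  have hPQ : P ∉ ({Q, R, S} : Finset X) := by rw [← hQ]; simp
  have hQ' : Q ∉ ({R, S} : Finset X) := by simp [hQR, hQS]
  rw [h2, sum_insert hPQ, sum_insert hQ', sum_pair hRS, hc] at hz
  have e1 : D.c S = -b - D.c Q - D.c R := by linear_combination hz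
  have hQ0 : D.c Q ≠ 0 := (D.mem_spt (l := l).1 (by rw [h2]; simp)).2
  have hR0 : D.c R ≠ 0 := (D.mem_spt (l := l).1 (by rw [h2]; simp)).2
  have hS0 : D.c S ≠ 0 := (D.mem_spt (l := l).1 (by rw [h2]; simp)).2
  refine ⟨D.c Q, D.c R, hQ0, hR0, e1 ▸ hS0, fun x hx => ?_⟩
  rw [D.mm_eq hx, h2, sum_insert hPQ, sum_insert hQ', sum_pair hRS, hc, e1]; ring

end PlaneCode

end

section
open Finset
namespace PlaneCode
variable {p : ℕ} {X Λ : Type} [Fintype X] [Fintype Λ] [DecidableEq X] [DecidableEq Λ]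
variable (D : PlaneCode p X Λ)
variable [hp : Fact p.Prime]

lemma coef_ne (hp7 : 7 ≤ p) {d : ZMod p} (hd : d ≠ 0) (i j : ℤ) (hij : i ≠ j) (h1 : i - j < 7)
    (h2 : j - i < 7) : (i : ZMod p) * d ≠ (j : ZMod p) * d := by
  intro h
  have h3 : ((i - j : ℤ) : ZMod p) = 0 := by
    have : ((i - j : ℤ) : ZMod p) * d = 0 := by push_cast; linear_combination h
    rcases mul_eq_zero.1 this with h | h
    · exact h
    · exact absurd h hd
  rw [ZMod.intCast_zmod_eq_zero_iff_dvd] at h3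
  obtain ⟨k, hk⟩ := h3
  have hk0 : k ≠ 0 := by rintro rfl; omega
  rcases lt_or_gt_of_ne hk0 with h | h <;> nlinarith

/-- basic consequences for a zero class -/
lemma Z1 (hp7 : 7 ≤ p) (he : D.e = 2) (hv0 : ∀ x, x ≠ 0 → 0 ≤ D.v x)
    {d : ZMod p} (hd : d ≠ 0) (vd : D.v d = 0) (vd' : D.v (-d) = 0) {P : X} (hP : D.c P = d)
    {Q : Λ} (hPQ : P ∈ D.pts Q) (hQ : 3 < D.sz Q) :
    D.sz Q = 4 ∧ D.mm Q (-2 * d) = D.mm Q d + D.v (-2 * d) ∧ 1 ≤ D.mm Q d ∧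
    ∀ x, x ≠ 0 → x ≠ d → 1 ≤ D.mm Q x → 1 ≤ D.v (-x) := by
  obtain ⟨h1, h2, h3, h4⟩ := D.v_G' hp7 he hd vd' hP hPQ hQ
  have hm := D.mm_pos hPQ hP
  refine ⟨h1, ?_, hm, ?_⟩
  · have := h4 d hd (ne_neg hp7 hd)
    rw [show -2 * d = -d - d by ring]; omega
  · intro x hx hxd hmx
    by_contra hcon
    have := hv0 (-x) (neg_ne_zero.2 hx)
    have := D.two_good hp7 he h1 hd hx hxd.symm vd' (by omega) hm hmx d hd
    omega

lemma Z1' (hp7 : 7 ≤ p) (hF : ∀ x : ZMod p, x ≠ 0 → ∃ P, D.c P = x) (he : D.e = 2)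
    (hv0 : ∀ x, x ≠ 0 → 0 ≤ D.v x)
    {d : ZMod p} (hd : d ≠ 0) (vd : D.v d = 0) (vd' : D.v (-d) = 0) : 1 ≤ D.v (2 * d) := by
  obtain ⟨P, hP⟩ := hF d hd
  obtain ⟨Q, hPQ, hQ, _⟩ := D.v_G hp7 he hd vd' hP
  obtain ⟨h1, h2, h3, h4⟩ := D.Z1 hp7 he hv0 hd vd vd' hP hPQ (by omega)
  have h20 : -2 * d ≠ 0 := fun h => two_ne_zero' hp7 hd (by linear_combination -h)
  have := hv0 _ h20
  have := h4 (-2 * d) h20 (fun h => two_ne_neg hp7 hd (by linear_combination -h)) (by omega)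
  rwa [show -(-2 * d) = 2 * d by ring] at this

lemma Z2 (hp7 : 7 ≤ p) (hF : ∀ x : ZMod p, x ≠ 0 → ∃ P, D.c P = x) (he : D.e = 2)
    (hv0 : ∀ x, x ≠ 0 → 0 ≤ D.v x)
    {d : ZMod p} (hd : d ≠ 0) (vd : D.v d = 0) (vd' : D.v (-d) = 0) {P : X} (hP : D.c P = d)
    {Q : Λ} (hPQ : P ∈ D.pts Q) (hQ : 3 < D.sz Q) :
    (∀ x, x ≠ 0 → D.mm Q x = (if x = d then 1 else 0) + 2 * (if x = -2 * d then 1 else 0)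
      + (if x = 3 * d then 1 else 0)) ∧ D.v (-2 * d) = 1 ∧ 1 ≤ D.v (-(3 * d)) := by
  obtain ⟨h1, h2, h3, h4⟩ := D.Z1 hp7 he hv0 hd vd vd' hP hPQ hQ
  have hv2 := D.Z1' hp7 hF he hv0 (neg_ne_zero.2 hd) vd' (by rwa [neg_neg])
  rw [show 2 * -d = -2 * d by ring] at hv2
  have h20 : -2 * d ≠ 0 := fun h => two_ne_zero' hp7 hd (by linear_combination -h)
  have h21 : -2 * d ≠ d := fun h => two_ne_neg hp7 hd (by linear_combination -h)
  have h30 : 3 * d ≠ 0 := by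
    have := smul_ne hp7 3 (by norm_num) (by norm_num) hd
    exact_mod_cast this
  have h31 : 3 * d ≠ d := fun h => two_ne_zero' hp7 hd (by linear_combination h)
  have h32 : 3 * d ≠ -2 * d := fun h =>
    smul_ne hp7 5 (by norm_num) (by norm_num) hd (by push_cast; linear_combination h)
  obtain ⟨y, z, hy, hz, ht, hm⟩ := D.four_line hPQ hP hd h1
  have hsum := D.mm_add_le_sz (l := Q) hd h20 h21.symm
  have hmd : D.mm Q d = 1 := by omega
  have hm2 : 2 ≤ D.mm Q (-2 * d) := by omega
  have g1 := hm _ h20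
  rw [if_neg h21] at g1
  have main : ∀ x, x ≠ 0 → D.mm Q x = (if x = d then 1 else 0) +
      2 * (if x = -2 * d then 1 else 0) + (if x = 3 * d then 1 else 0) := by
    by_cases e1 : -2 * d = y
    · by_cases e2 : -2 * d = z
      · intro x hx
        rw [hm x hx, ← e1, ← e2, show -d - -2 * d - -2 * d = 3 * d by ring]; ring
      · rw [if_pos e1, if_neg e2] at g1
        have e3 : -2 * d = -d - y - z := by by_contra e3; rw [if_neg e3] at g1; omega
        have e4 : z = 3 * d := by rw [← e1] at e3; linear_combination e3
        intro x hx
        rw [hm x hx, ← e3, ← e1, e4]; ring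
    · rw [if_neg e1] at g1
      have e2 : -2 * d = z := by by_contra e2; rw [if_neg e2] at g1; split_ifs at g1 <;> omega
      rw [if_pos e2] at g1
      have e3 : -2 * d = -d - y - z := by by_contra e3; rw [if_neg e3] at g1; omega
      have e4 : y = 3 * d := by rw [← e2] at e3; linear_combination e3
      intro x hx
      rw [hm x hx, ← e3, ← e2, e4]; ring
  refine ⟨main, ?_, ?_⟩
  · have := main _ h20
    rw [if_neg h21, if_pos rfl, if_neg h32.symm] at this
    omega
  · apply h4 _ h30 h31
    rw [main _ h30, if_neg h31, if_neg h32, if_pos rfl]; norm_num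

lemma parity_sum {ι : Type} (s : Finset ι) (g : ι → ℤ) :
    (2 : ℤ) ∣ ∑ i ∈ s, g i - ∑ i ∈ s, g i % 2 := by
  rw [← sum_sub_distrib]
  apply dvd_sum
  intro i _
  omega

lemma zero_class (hp7 : 7 ≤ p) (hF : ∀ x : ZMod p, x ≠ 0 → ∃ P, D.c P = x) (he : D.e = 2)
    (hv0 : ∀ x, x ≠ 0 → 0 ≤ D.v x)
    {d : ZMod p} (hd : d ≠ 0) (vd : D.v d = 0) (vd' : D.v (-d) = 0) : False := by
  have hd' := neg_ne_zero.2 hd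
  have vd'' : D.v (- -d) = 0 := by rwa [neg_neg]
  obtain ⟨P, hP⟩ := hF d hd
  obtain ⟨P', hP'⟩ := hF (-d) hd'
  obtain ⟨Q, hPQ, hQ, _⟩ := D.v_G hp7 he hd vd' hP
  obtain ⟨Q', hPQ', hQ', _⟩ := D.v_G hp7 he hd' vd'' hP'
  obtain ⟨a1, a2, a3⟩ := D.Z2 hp7 hF he hv0 hd vd vd' hP hPQ (by omega)
  obtain ⟨b1, b2, b3⟩ := D.Z2 hp7 hF he hv0 hd' vd' vd'' hP' hPQ' (by omega)
  rw [show -2 * -d = 2 * d by ring] at b2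
  rw [show -(3 * -d) = 3 * d by ring] at b3
  rw [show -(3 * d) = -3 * d by ring] at a3
  have cn : ∀ i j : ℤ, i ≠ j → i - j < 7 → j - i < 7 → (i : ZMod p) * d ≠ (j : ZMod p) * d :=
    fun i j => coef_ne hp7 hd i j
  have c02 := cn 0 2 (by norm_num) (by norm_num) (by norm_num)
  have c03 := cn 0 3 (by norm_num) (by norm_num) (by norm_num)
  have c02' := cn 0 (-2) (by norm_num) (by norm_num) (by norm_num)
  have c03' := cn 0 (-3) (by norm_num) (by norm_num) (by norm_num)
  have c22 := cn 2 (-2) (by norm_num) (by norm_num) (by norm_num)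
  have c23 := cn 2 3 (by norm_num) (by norm_num) (by norm_num)
  have c23' := cn 2 (-3) (by norm_num) (by norm_num) (by norm_num)
  have c32 := cn (-2) 3 (by norm_num) (by norm_num) (by norm_num)
  have c32' := cn (-2) (-3) (by norm_num) (by norm_num) (by norm_num)
  have c33 := cn 3 (-3) (by norm_num) (by norm_num) (by norm_num)
  have c12 := cn 1 (-2) (by norm_num) (by norm_num) (by norm_num)
  have c13 := cn 1 3 (by norm_num) (by norm_num) (by norm_num)
  have d12 := cn (-1) (-2) (by norm_num) (by norm_num) (by norm_num)
  have d11 := cn (-1) 1 (by norm_num) (by norm_num) (by norm_num)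
  have d13 := cn (-1) 3 (by norm_num) (by norm_num) (by norm_num)
  push_cast at c02 c03 c02' c03' c22 c23 c23' c32 c32' c33 c12 c13 d12 d11 d13
  simp only [zero_mul, one_mul, neg_one_mul] at c02 c03 c02' c03' c12 c13 d12 d11 d13
  have hv3 : D.v (3 * d) ≤ 1 := by
    have hs := D.sum_v he
    have := sub_sum (v := D.v) {2 * d, -2 * d, 3 * d, -3 * d} (by
      simp only [mem_insert, mem_singleton]; tauto) (fun x hx _ => hv0 x hx)
    rw [sum_insert (by simp only [mem_insert, mem_singleton]; tauto),
        sum_insert (by simp only [mem_insert, mem_singleton]; tauto),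
        sum_insert (by simp only [mem_singleton]; tauto), sum_singleton] at this
    omega
  obtain ⟨R, hRQ, hR⟩ := D.exists_of_mm (l := Q) (b := -2 * d) (by
    rw [a1 _ c02'.symm, if_neg c12.symm, if_pos rfl, if_neg c32]; norm_num)
  -- the local inequality
  have key : ∀ l ∈ D.thr R, D.mm l (-d) + D.mm l d % 2 ≤ D.mm l (3 * d) := by
    intro l hl
    have hl := D.mem_thr.1 hl
    have hmR := D.mm_pos hl hR
    have hn1 := D.mm_nonneg l (-d)
    have hn2 := D.mm_nonneg l d
    have hn3 := D.mm_nonneg l (3 * d)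
    have hR0 : D.c R ≠ 0 := by rw [hR]; exact c02'.symm
    have hsz := D.sz_ge2 hl hR0
    by_cases hm : 1 ≤ D.mm l (-d)
    · obtain ⟨S, hSl, hS⟩ := D.exists_of_mm hm
      by_cases h3 : 3 < D.sz l
      · exfalso
        obtain ⟨z1, _⟩ := D.Z2 hp7 hF he hv0 hd' vd' vd'' hS hSl h3
        rw [z1 _ c02'.symm, if_neg d12.symm, if_neg (by
            rw [show -2 * -d = 2 * d by ring]; exact c22.symm), if_neg (by
            rw [show 3 * -d = -3 * d by ring]; exact c32')] at hmR
        omega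
      · rcases hsz.eq_or_lt with h2 | h2
        · exfalso
          rw [D.two_line hSl hS hd' h2.symm _ c02'.symm, if_neg d12.symm, neg_neg,
            if_neg c12.symm] at hmR
          omega
        · obtain ⟨y, hy, hy2, hmm⟩ := D.three_line hl hR c02'.symm (by omega)
          have e1 := hmm _ hd'
          rw [if_neg d12] at e1
          have hcase : y = -d ∨ y = 3 * d := by
            by_cases q : -d = y
            · exact Or.inl q.symm
            · rw [if_neg q] at e1
              by_cases q2 : -d = -(-2 * d) - y
              · right; linear_combination q2
              · rw [if_neg q2] at e1; omega
          have m1 : D.mm l (-d) = 1 := by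
            rw [e1]
            rcases hcase with rfl | rfl
            · rw [if_pos rfl, if_neg (by rw [show -(-2 * d) - -d = 3 * d by ring]; exact d13)]
              norm_num
            · rw [if_neg d13, if_pos (by ring)]; norm_num
          have m2 : D.mm l d = 0 := by
            rw [hmm _ hd, if_neg c12]
            rcases hcase with rfl | rfl
            · rw [if_neg d11.symm, if_neg (by rw [show -(-2 * d) - -d = 3 * d by ring]; exact c13)]
              norm_num
            · rw [if_neg c13, if_neg (by rw [show -(-2 * d) - 3 * d = - d by ring]; exact d11.symm)]
              norm_num
          have m3 : 1 ≤ D.mm l (3 * d) := by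
            rw [hmm _ c03.symm, if_neg c32.symm]
            rcases hcase with rfl | rfl
            · rw [if_neg d13.symm, if_pos (by ring)]; norm_num
            · rw [if_pos rfl]; split_ifs <;> norm_num
          omega
    · by_cases hm2 : 1 ≤ D.mm l d
      · obtain ⟨S, hSl, hS⟩ := D.exists_of_mm hm2
        by_cases h3 : 3 < D.sz l
        · obtain ⟨z1, _⟩ := D.Z2 hp7 hF he hv0 hd vd vd' hS hSl h3
          have m1 := z1 _ hd
          have m2 := z1 _ c03.symm
          rw [if_pos rfl, if_neg c12, if_neg c13] at m1
          rw [if_neg c13.symm, if_neg c32.symm, if_pos rfl] at m2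
          omega
        · rcases hsz.eq_or_lt with h2 | h2
          · exfalso
            rw [D.two_line hSl hS hd h2.symm _ c02'.symm, if_neg d12.symm,
              if_neg c12.symm] at hmR
            omega
          · obtain ⟨y, hy, hy2, hmm⟩ := D.three_line hl hR c02'.symm (by omega)
            have e1 := hmm _ hd
            rw [if_neg c12] at e1
            have hcase : y = d := by
              by_cases q : d = y
              · exact q.symm
              · rw [if_neg q] at e1
                by_cases q2 : d = -(-2 * d) - y
                · linear_combination q2
                · rw [if_neg q2] at e1; omega
            rw [hcase, if_pos rfl, if_pos (by ring)] at e1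
            omega
      · omega
  have hs := sum_le_sum key
  rw [sum_add_distrib, D.sum_mm, D.sum_mm, D.ind_ne (by rw [hR]; exact d12.symm),
    D.ind_ne (by rw [hR]; exact c32)] at hs
  have hpar := parity_sum (D.thr R) (fun l => D.mm l d)
  have hsd := D.sum_mm d R
  rw [D.ind_ne (by rw [hR]; exact c12.symm)] at hsd
  simp only [hsd] at hpar
  have h1 : 1 ≤ ∑ l ∈ D.thr R, D.mm l d % 2 := by
    have := single_le_sum (f := fun l => D.mm l d % 2) (fun i _ => Int.emod_nonneg _ (by norm_num))
      (D.mem_thr.2 hRQ)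
    have m1 := a1 _ hd
    rw [if_pos rfl, if_neg c12, if_neg c13] at m1
    simp only [m1] at this
    norm_num at this
    omega
  unfold v at vd vd' hv3
  omega

end PlaneCode

end

section
open Finset
namespace PlaneCode

set_option maxHeartbeats 4000000 in
lemma enum7 {a1 a2 a3 a4 a5 a6 : ℤ} (h1 : 0 ≤ a1) (h2 : 0 ≤ a2) (h3 : 0 ≤ a3) (h4 : 0 ≤ a4)
    (h5 : 0 ≤ a5) (h6 : 0 ≤ a6) (hs : a1 + a2 + a3 + a4 + a5 + a6 = 4) (h16 : 1 ≤ a1 + a6)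
    (h25 : 1 ≤ a2 + a5) (h34 : 1 ≤ a3 + a4)
    (hm : (a1 + 2 * a2 + 3 * a3 + 4 * a4 + 5 * a5 + 6 * a6) % 7 = 0) :
    (a1 = 2 ∧ a2 = 1 ∧ a3 = 1) ∨ (a2 = 2 ∧ a4 = 1 ∧ a6 = 1) ∨ (a3 = 2 ∧ a6 = 1 ∧ a2 = 1) ∨
    (a4 = 2 ∧ a1 = 1 ∧ a5 = 1) ∨ (a5 = 2 ∧ a3 = 1 ∧ a1 = 1) ∨ (a6 = 2 ∧ a5 = 1 ∧ a4 = 1) := by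
  have b1 : a1 ≤ 2 := by omega
  have b2 : a2 ≤ 2 := by omega
  have b3 : a3 ≤ 2 := by omega
  have b4 : a4 ≤ 2 := by omega
  have b5 : a5 ≤ 2 := by omega
  obtain rfl : a6 = 4 - a1 - a2 - a3 - a4 - a5 := by omega
  clear hs
  interval_cases a1 <;> interval_cases a2 <;> interval_cases a3 <;> interval_cases a4 <;>
    interval_cases a5 <;> simp at h6 h16 h25 h34 hm ⊢

lemma enum7' {v : ZMod 7 → ℤ} (h : ∀ x, x ≠ 0 → 0 ≤ v x)
    (hs : ∑ x ∈ (univ : Finset (ZMod 7)).erase 0, v x = 4)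
    (hz : ∀ x, x ≠ 0 → 1 ≤ v x + v (-x)) (hm : ∑ x : ZMod 7, x * ((v x : ℤ) : ZMod 7) = 0) :
    ∃ y, y ≠ 0 ∧ v y = 2 ∧ v (2 * y) = 1 ∧ v (3 * y) = 1 ∧ v (-y) = 0 ∧ v (-(2 * y)) = 0 ∧
      v (-(3 * y)) = 0 := by
  have hs' : v 1 + v 2 + v 3 + v 4 + v 5 + v 6 = 4 := by
    rw [← hs, show (univ : Finset (ZMod 7)).erase 0 = {1, 2, 3, 4, 5, 6} by decide]
    rw [sum_insert (by decide), sum_insert (by decide), sum_insert (by decide),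
      sum_insert (by decide), sum_insert (by decide), sum_singleton]; ring
  have hm' : (v 1 + 2 * v 2 + 3 * v 3 + 4 * v 4 + 5 * v 5 + 6 * v 6) % 7 = 0 := by
    apply Int.emod_eq_zero_of_dvd
    have : ((7 : ℕ) : ℤ) ∣ (v 1 + 2 * v 2 + 3 * v 3 + 4 * v 4 + 5 * v 5 + 6 * v 6) := by
      rw [← ZMod.intCast_zmod_eq_zero_iff_dvd]
      rw [show (univ : Finset (ZMod 7)) = {0, 1, 2, 3, 4, 5, 6} by decide] at hm
      rw [sum_insert (by decide), sum_insert (by decide), sum_insert (by decide),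
        sum_insert (by decide), sum_insert (by decide), sum_insert (by decide),
        sum_singleton] at hm
      push_cast
      linear_combination hm
    exact_mod_cast this
  have n1 := h 1 (by decide)
  have n2 := h 2 (by decide)
  have n3 := h 3 (by decide)
  have n4 := h 4 (by decide)
  have n5 := h 5 (by decide)
  have n6 := h 6 (by decide)
  have z1 := hz 1 (by decide)
  have z2 := hz 2 (by decide)
  have z3 := hz 3 (by decide)
  rw [show (-1 : ZMod 7) = 6 by decide] at z1
  rw [show (-2 : ZMod 7) = 5 by decide] at z2
  rw [show (-3 : ZMod 7) = 4 by decide] at z3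
  have key : ∀ y, y ≠ 0 → v y = 2 → v (2 * y) = 1 → v (3 * y) = 1 →
      (v y + v (2 * y) + v (3 * y) + v (-y) + v (-(2 * y)) + v (-(3 * y)) = 4) →
      ∃ y, y ≠ 0 ∧ v y = 2 ∧ v (2 * y) = 1 ∧ v (3 * y) = 1 ∧ v (-y) = 0 ∧ v (-(2 * y)) = 0 ∧
      v (-(3 * y)) = 0 := by
    intro y hy h1 h2 h3 h4
    have g1 := h (-y) (neg_ne_zero.2 hy)
    have q2 : ∀ y : ZMod 7, y ≠ 0 → -(2 * y) ≠ 0 := by decide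
    have q3 : ∀ y : ZMod 7, y ≠ 0 → -(3 * y) ≠ 0 := by decide
    have g2 := h (-(2 * y)) (q2 y hy)
    have g3 := h (-(3 * y)) (q3 y hy)
    exact ⟨y, hy, h1, h2, h3, by omega, by omega, by omega⟩
  rcases enum7 n1 n2 n3 n4 n5 n6 hs' z1 z2 z3 hm' with h | h | h | h | h | h
  · exact key 1 (by decide) h.1 h.2.1 h.2.2 (by change v 1 + v 2 + v 3 + v 6 + v 5 + v 4 = 4; omega)
  · exact key 2 (by decide) h.1 h.2.1 h.2.2 (by change v 2 + v 4 + v 6 + v 5 + v 3 + v 1 = 4; omega)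
  · exact key 3 (by decide) h.1 h.2.1 h.2.2 (by change v 3 + v 6 + v 2 + v 4 + v 1 + v 5 = 4; omega)
  · exact key 4 (by decide) h.1 h.2.1 h.2.2 (by change v 4 + v 1 + v 5 + v 3 + v 6 + v 2 = 4; omega)
  · exact key 5 (by decide) h.1 h.2.1 h.2.2 (by change v 5 + v 3 + v 1 + v 2 + v 4 + v 6 = 4; omega)
  · exact key 6 (by decide) h.1 h.2.1 h.2.2 (by change v 6 + v 5 + v 4 + v 1 + v 2 + v 3 = 4; omega)

variable {p : ℕ} {X Λ : Type} [Fintype X] [Fintype Λ] [DecidableEq X] [DecidableEq Λ]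
variable (D : PlaneCode p X Λ)
variable [hp : Fact p.Prime]

lemma nozero_exists (hp7 : 7 ≤ p) (he : D.e = 2) (hv0 : ∀ x, x ≠ 0 → 0 ≤ D.v x)
    (hnz : ∀ x, x ≠ 0 → 1 ≤ D.v x + D.v (-x)) (P : X) : p = 7 ∧
    ∃ y, y ≠ 0 ∧ D.v y = 2 ∧ D.v (2 * y) = 1 ∧ D.v (3 * y) = 1 ∧ D.v (-y) = 0 ∧
      D.v (-(2 * y)) = 0 ∧ D.v (-(3 * y)) = 0 := by
  have hs := D.sum_v he
  have h1 : ∑ d ∈ (univ : Finset (ZMod p)).erase 0, (1 : ℤ)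
      ≤ ∑ d ∈ (univ : Finset (ZMod p)).erase 0, (D.v d + D.v (-d)) :=
    sum_le_sum fun d hd => hnz d (ne_of_mem_erase hd)
  rw [sum_const, nsmul_eq_mul, card_nz, sum_add_distrib, sum_nz_neg (fun d => D.v d), hs] at h1
  have h7 : p = 7 := prime_seven hp.out hp7 (by omega)
  have hm := D.sum_n_weighted P
  have hm2 : ∑ d : ZMod p, d * ((D.v d : ℤ) : ZMod p) = 0 := by
    rw [← hm]
    apply sum_congr rfl
    intro d _
    unfold v; push_cast; simp
  refine ⟨h7, ?_⟩
  subst h7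
  exact enum7' hv0 hs hnz (by convert hm2)

lemma nozero_false (hp7 : 7 ≤ p) (hF : ∀ x : ZMod p, x ≠ 0 → ∃ P, D.c P = x) (he : D.e = 2)
    (hv0 : ∀ x, x ≠ 0 → 0 ≤ D.v x) (hnz : ∀ x, x ≠ 0 → 1 ≤ D.v x + D.v (-x)) : False := by
  obtain ⟨P0, _⟩ := hF 1 one_ne_zero
  obtain ⟨h7, y, hy, v1, v2, v3, w1, w2, w3⟩ := D.nozero_exists hp7 he hv0 hnz P0
  have h70 := seven_zero h7
  have h20 := two_ne_zero' hp7 hy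
  have h30 : 3 * y ≠ 0 := by
    have := smul_ne hp7 3 (by norm_num) (by norm_num) hy
    exact_mod_cast this
  have h12 : y ≠ 2 * y := fun h => hy (by linear_combination -h)
  -- structure of four secants through the points of value twice y
  have hQ : ∀ P, D.c P = 2 * y → ∃ Q, P ∈ D.pts Q ∧ D.sz Q = 4 ∧ 2 ≤ D.mm Q y ∧
      D.mm Q (2 * y) = 1 := by
    intro P hP
    obtain ⟨Q, g1, g2, g3, g4, g5⟩ := D.v_G hp7 he h20 w2 hP
    have e1 := g5 y hy (fun h => h30 (by linear_combination h))
    have e2 := g5 (2 * y) h20 (ne_neg hp7 h20)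
    rw [show -(2 * y) - y = -(3 * y) by ring] at e1
    rw [show -(2 * y) - 2 * y = 3 * y by linear_combination -y * h70] at e2
    have n1 := D.mm_nonneg Q (-(3 * y))
    have m1 := D.mm_pos g1 hP
    refine ⟨Q, g1, g2, by omega, ?_⟩
    have : D.mm Q y + D.mm Q (2 * y) + D.mm Q (3 * y) ≤ D.sz Q := by
      unfold mm sz
      rw [← sum_add_distrib, ← sum_add_distrib]
      apply sum_le_sum
      intro x _
      by_cases q1 : D.c x = y
      · rw [D.ind_self q1, D.ind_ne (by rw [q1]; exact h12),
          D.ind_ne (by rw [q1]; exact fun h => h20 (by linear_combination -h)), D.sup_self hy q1]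
        norm_num
      · by_cases q2 : D.c x = 2 * y
        · rw [D.ind_self q2, D.ind_ne q1,
            D.ind_ne (by rw [q2]; exact fun h => hy (by linear_combination -h)), D.sup_self h20 q2]
          norm_num
        · rw [D.ind_ne q1, D.ind_ne q2]
          by_cases q3 : D.c x = 3 * y
          · rw [D.ind_self q3, D.sup_self h30 q3]; norm_num
          · rw [D.ind_ne q3]; have := D.sup_nonneg x; omega
    omega
  let 𝒬 : Finset Λ := univ.filter fun l => D.sz l = 4 ∧ 2 ≤ D.mm l y ∧ D.mm l (2 * y) = 1
  have hcount : ∀ b, ∑ l ∈ 𝒬, D.mm l b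
      = ∑ x, ∑ l ∈ 𝒬, if x ∈ D.pts l then D.ind b x else 0 := by
    intro b
    rw [sum_comm]
    apply sum_congr rfl
    intro l _
    rw [← sum_filter]; unfold mm; congr 1; ext x; simp
  have hA : D.n (2 * y) ≤ ∑ l ∈ 𝒬, D.mm l (2 * y) := by
    rw [hcount]
    unfold n
    apply sum_le_sum
    intro x _
    have hnn : ∀ l ∈ 𝒬, 0 ≤ if x ∈ D.pts l then D.ind (2 * y) x else 0 := fun l _ => by
      split_ifs
      · exact D.ind_nonneg _ _
      · exact le_refl _
    by_cases hx : D.c x = 2 * y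
    · obtain ⟨Q, g1, g2, g3, g4⟩ := hQ x hx
      have := single_le_sum hnn (show Q ∈ 𝒬 by simp [𝒬, g2, g3, g4])
      rwa [if_pos g1] at this
    · rw [D.ind_ne hx]; simp
  have hB : ∑ l ∈ 𝒬, D.mm l y ≤ D.n y := by
    rw [hcount]
    unfold n
    apply sum_le_sum
    intro x _
    by_cases hx : D.c x = y
    · obtain ⟨Q, g1, g2, g3, g4, g5⟩ := D.v_G hp7 he hy w1 hx
      calc _ ≤ ∑ l ∈ 𝒬, if l = Q then D.ind y x else 0 := by
            apply sum_le_sum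
            intro l hl
            by_cases hlQ : l = Q
            · subst hlQ; rw [if_pos g1, if_pos rfl]
            · rw [if_neg hlQ, if_neg]
              intro hxl
              have := g4 l hxl hlQ
              simp [𝒬] at hl
              omega
        _ ≤ _ := by
            rw [sum_ite_eq']
            split_ifs
            · exact le_refl _
            · exact D.ind_nonneg _ _
    · rw [D.ind_ne hx]; simp
  have hC : ∑ l ∈ 𝒬, 2 * D.mm l (2 * y) ≤ ∑ l ∈ 𝒬, D.mm l y := by
    apply sum_le_sum
    intro l hl
    simp [𝒬] at hl
    omega
  rw [← mul_sum] at hC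
  unfold v at v1 v2
  omega

lemma e2_false (hp7 : 7 ≤ p) (hF : ∀ x : ZMod p, x ≠ 0 → ∃ P, D.c P = x) (he : D.e = 2) :
    False := by
  have hK := D.v_K hp7 hF he
  have hs := D.sum_v he
  have hge := D.v_ge hp7 hF he
  by_cases h : ∃ x, x ≠ 0 ∧ D.v x = -1
  · obtain ⟨x, hx, vx⟩ := h
    refine D.K1_false hp7 hF he (b := -x) (neg_ne_zero.2 hx) (by rwa [neg_neg]) ?_
    intro z hz hzx
    rw [neg_neg] at hzx
    by_contra hcon
    have := hge z hz
    exact K2_false hp7 hK hs (b := -x) (d := -z) (neg_ne_zero.2 hx) (neg_ne_zero.2 hz)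
      (fun h => hzx (neg_injective h).symm) (by rwa [neg_neg]) (by rw [neg_neg]; omega)
  · push Not at h
    have hv0 : ∀ x, x ≠ 0 → 0 ≤ D.v x := fun x hx => by
      have := hge x hx; have := h x hx; omega
    apply D.nozero_false hp7 hF he hv0
    intro x hx
    by_contra hcon
    have h1 := hv0 x hx
    have h2 := hv0 (-x) (neg_ne_zero.2 hx)
    exact D.zero_class hp7 hF he hv0 hx (by omega) (by omega)

/-- at most two values -/
theorem two_values (hp7 : 7 ≤ p) (he : D.e ≤ 2) {b d : ZMod p} (hb : b ≠ 0) (hd : d ≠ 0)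
    (hHb : ∃ x, D.c x = b) (hHd : ∃ x, D.c x = d) : d = b ∨ d = -b := by
  by_contra! hcon
  obtain ⟨a, ha, h1, h2⟩ := D.exists_double hp7 he hb hd hHb hHd hcon.1 hcon.2
  have hF := D.full hp7 he ha h1 h2
  by_cases h : D.e ≤ 1
  · exact D.e1_false hp7 hF h
  · exact D.e2_false hp7 hF (by omega)

end PlaneCode

end

section
open Finset
namespace PlaneCode
variable {p : ℕ} {X Λ : Type} [Fintype X] [Fintype Λ] [DecidableEq X] [DecidableEq Λ]
variable (D : PlaneCode p X Λ)
variable [hp : Fact p.Prime]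

lemma r_two (hp7 : 7 ≤ p) {b : ZMod p} (hb : b ≠ 0)
    (H : ∀ x, D.c x = 0 ∨ D.c x = b ∨ D.c x = -b) (x : X) :
    D.r b x = D.ind b x + (p - 1) * D.ind (-b) x := by
  have h2 := ne_neg hp7 hb
  rcases H x with h | h | h
  · rw [D.r_zero h, D.ind_ne (by rw [h]; exact hb.symm),
      D.ind_ne (by rw [h]; exact (neg_ne_zero.2 hb).symm)]; ring
  · rw [D.r_self hb h, D.ind_self h, D.ind_ne (by rw [h]; exact h2)]; ring
  · rw [D.r_neg_self hb h, D.ind_self h, D.ind_ne (by rw [h]; exact h2.symm)]; ring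

lemma pk_two (hp7 : 7 ≤ p) {b : ZMod p} (hb : b ≠ 0)
    (H : ∀ x, D.c x = 0 ∨ D.c x = b ∨ D.c x = -b) (l : Λ) :
    (p : ℤ) * D.k b l = D.mm l b + (p - 1) * D.mm l (-b) := by
  rw [D.pk, sum_congr rfl fun x _ => D.r_two hp7 hb H x, sum_add_distrib, ← mul_sum]; rfl

lemma T_two (hp7 : 7 ≤ p) {b : ZMod p} (hb : b ≠ 0)
    (H : ∀ x, D.c x = 0 ∨ D.c x = b ∨ D.c x = -b) :
    D.T b = D.n b + (p - 1) * D.n (-b) := by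
  unfold T
  rw [sum_congr rfl fun x _ => D.r_two hp7 hb H x, sum_add_distrib, ← mul_sum]; rfl

lemma H_swap {b : ZMod p} (H : ∀ x, D.c x = 0 ∨ D.c x = b ∨ D.c x = -b) :
    ∀ x, D.c x = 0 ∨ D.c x = -b ∨ D.c x = - -b := fun x => by
  rw [neg_neg]; have := H x; tauto

lemma arith_two {q x d : ℤ} (hq : 7 ≤ q) (h : (q - 2) * x = q * d) (h1 : -2 ≤ d) (h2 : d ≤ 2) :
    d = 0 ∧ x = 0 := by
  have h3 : (q - 2) * (x - d) = 2 * d := by linear_combination h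
  have h4 : x - d = 0 := by
    by_contra hne
    rcases lt_or_gt_of_ne hne with g | g
    · nlinarith
    · nlinarith
  rw [h4] at h3
  constructor <;> omega

lemma two_counts (hp7 : 7 ≤ p) (he : D.e ≤ 2) {b : ZMod p} (hb : b ≠ 0)
    (H : ∀ x, D.c x = 0 ∨ D.c x = b ∨ D.c x = -b) {P : X} (hP : D.c P = b) :
    0 ≤ D.E b ∧ D.E b ≤ 1 ∧ D.E (-b) = D.E b ∧ D.n b = p ^ 2 - p + 1 + D.E b ∧
      D.n (-b) = D.n b := by
  have hnb := neg_ne_zero.2 hb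
  have h7 : (7 : ℤ) ≤ p := by exact_mod_cast hp7
  obtain ⟨Q, hQ⟩ := D.exists_of_n (b := -b) (by
    have := D.n_neg_ge hp7 hP hb; omega)
  have e1 := D.E_nonneg hb hP
  have e2 := D.E_nonneg hnb hQ
  have e3 := D.E_add hb P
  have e4 : D.e = D.w - 2 * (p ^ 2 - p + 1) := rfl
  have t1 := D.T_two hp7 hb H
  have t2 := D.T_two hp7 hnb (D.H_swap H)
  rw [D.T_eq _ P] at t1 t2
  rw [neg_neg] at t2
  obtain ⟨g1, g2⟩ := arith_two h7 (x := D.n (-b) - D.n b) (d := D.E b - D.E (-b))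
    (by linear_combination t2 - t1) (by omega) (by omega)
  refine ⟨e1, by omega, by omega, ?_, by omega⟩
  apply mul_left_cancel₀ (show (p : ℤ) ≠ 0 by omega)
  have g3 : D.n (-b) = D.n b := by omega
  rw [g3] at t1
  linear_combination -t1

lemma k_le_two (hp7 : 7 ≤ p) (he : D.e ≤ 2) {b : ZMod p} (hb : b ≠ 0)
    (H : ∀ x, D.c x = 0 ∨ D.c x = b ∨ D.c x = -b) {P : X} (hP : D.c P = b) {l : Λ}
    (hl : P ∈ D.pts l) : 1 ≤ D.k b l ∧ D.k b l ≤ 2 := by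
  obtain ⟨e1, e2, -⟩ := D.two_counts hp7 he hb H hP
  have hpos : ∀ l ∈ D.thr P, 0 ≤ D.k b l - 1 := fun l hl => by
    have := D.k_pos hb (D.mem_thr.1 hl) (by rw [hP]; exact hb)
    omega
  have h1 := D.sum_k1 b P
  rw [D.r_self hb hP] at h1
  have h2 := single_le_sum hpos (D.mem_thr.2 hl)
  have h3 := hpos l (D.mem_thr.2 hl)
  constructor <;> linarith

lemma line_types (hp7 : 7 ≤ p) (he : D.e ≤ 2) {b : ZMod p} (hb : b ≠ 0)
    (H : ∀ x, D.c x = 0 ∨ D.c x = b ∨ D.c x = -b) {P : X} (hP : D.c P = b) {l : Λ}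
    (hl : P ∈ D.pts l) :
    D.mm l b = 1 ∨ (D.mm l b = 2 ∧ D.k b l = 2) ∨ D.mm l b = p ∨ D.mm l b = 2 * p := by
  have h7 : (7 : ℤ) ≤ p := by exact_mod_cast hp7
  have hnb := neg_ne_zero.2 hb
  have k1 := D.k_le_two hp7 he hb H hP hl
  have q1 := D.pk_two hp7 hb H l
  have q2 := D.pk_two hp7 hnb (D.H_swap H) l
  rw [neg_neg] at q2
  rcases (D.mm_nonneg l (-b)).eq_or_lt with h | h
  · rw [← h] at q1
    have : D.k b l = 1 ∨ D.k b l = 2 := by omega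
    rcases this with g | g <;> rw [g] at q1
    · right; right; left; linarith
    · right; right; right; linarith
  · obtain ⟨Q, hQ, hc⟩ := D.exists_of_mm (l := l) (b := -b) (by omega)
    have he2 := D.e
    have k2 := D.k_le_two hp7 he hnb (D.H_swap H) hc hQ
    obtain ⟨g1, g2⟩ := arith_two h7 (x := D.mm l (-b) - D.mm l b) (d := D.k b l - D.k (-b) l)
      (by linear_combination q2 - q1) (by omega) (by omega)
    have g3 : D.mm l (-b) = D.mm l b := by omega
    rw [g3] at q1
    have : D.k b l = D.mm l b := by
      apply mul_left_cancel₀ (show (p : ℤ) ≠ 0 by omega)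
      linear_combination q1
    omega

lemma no_2p (hp7 : 7 ≤ p) (he : D.e ≤ 2) {b : ZMod p} (hb : b ≠ 0)
    (H : ∀ x, D.c x = 0 ∨ D.c x = b ∨ D.c x = -b) {P : X} (hP : D.c P = b) (l : Λ) :
    D.mm l b ≠ 2 * p := by
  intro h2p
  have h7 : (7 : ℤ) ≤ p := by exact_mod_cast hp7
  obtain ⟨e1, e2, e3, e4, e5⟩ := D.two_counts hp7 he hb H hP
  have hR : ∃ R, D.c R = b ∧ R ∉ D.pts l := by
    by_contra! hcon
    have : D.n b ≤ D.mm l b := by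
      have : D.n b = D.mm l b := by
        unfold n mm
        symm
        apply sum_subset (subset_univ _)
        intro x _ hx
        exact D.ind_ne fun h => hx (hcon x h)
      omega
    nlinarith
  obtain ⟨R, hR, hRl⟩ := hR
  have hd := D.dc (fun x => if x ∈ D.pts l then D.ind b x else 0) R
  rw [if_neg hRl, ← sum_filter, show univ.filter (fun x => x ∈ D.pts l) = D.pts l by ext; simp,
    show ∑ x ∈ D.pts l, D.ind b x = D.mm l b from rfl, h2p] at hd
  have hle : ∀ m ∈ D.thr R, (p - 1 : ℤ) * (∑ x ∈ D.pts m, if x ∈ D.pts l then D.ind b x else 0)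
      ≤ (D.mm m b - 1) + (p - 2) * (D.k b m - 1) := by
    intro m hm
    have hm := D.mem_thr.1 hm
    have hk := (D.k_le_two hp7 he hb H hR hm).1
    have ht := D.line_types hp7 he hb H hR hm
    have hm1 := D.mm_pos hm hR
    by_cases hx : ∃ x ∈ D.pts m, x ∈ D.pts l ∧ D.c x = b
    · obtain ⟨x, hxm, hxl, hxb⟩ := hx
      have hxR : x ≠ R := fun h => hRl (h ▸ hxl)
      have hs : (∑ x ∈ D.pts m, if x ∈ D.pts l then D.ind b x else 0) = 1 := by
        rw [sum_eq_single x]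
        · rw [if_pos hxl, D.ind_self hxb]
        · intro y hy hyx
          rw [if_neg]
          intro hyl
          obtain ⟨l0, -, hu⟩ := D.line y x hyx
          have : m = l := (hu m ⟨hy, hxm⟩).trans (hu l ⟨hyl, hxl⟩).symm
          exact hRl (this ▸ hm)
        · intro h; exact absurd hxm h
      have h2 : 2 ≤ D.mm m b := by
        have : ∑ y ∈ {x, R}, D.ind b y ≤ D.mm m b := by
          apply sum_le_sum_of_subset_of_nonneg
          · intro y hy
            simp at hy
            rcases hy with rfl | rfl <;> assumption
          · intro y _ _; exact D.ind_nonneg _ _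
        rw [sum_pair hxR, D.ind_self hxb, D.ind_self hR] at this
        omega
      rw [hs]
      rcases ht with h | ⟨h, hk2⟩ | h | h
      · omega
      · rw [h, hk2]; linarith
      · rw [h]; nlinarith
      · rw [h]; nlinarith
    · have hs : (∑ x ∈ D.pts m, if x ∈ D.pts l then D.ind b x else 0) = 0 := by
        apply sum_eq_zero
        intro x hx'
        split_ifs with hxl
        · exact D.ind_ne fun h => hx ⟨x, hx', hxl, h⟩
        · rfl
      rw [hs]; nlinarith
  have hsum := sum_le_sum hle
  rw [← mul_sum, hd, sum_add_distrib, ← mul_sum, D.sum_k1, D.r_self hb hR, sum_sub_distrib,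
    D.sum_mm, D.ind_self hR, sum_const, nsmul_eq_mul, D.card_thr, e4] at hsum
  nlinarith

/-- structure of the positive part in the two-valued case -/
theorem structure_A (hp7 : 7 ≤ p) (he : D.e ≤ 2) {b : ZMod p} (hb : b ≠ 0)
    (H : ∀ x, D.c x = 0 ∨ D.c x = b ∨ D.c x = -b) {P : X} (hP : D.c P = b) :
    (∀ l, P ∈ D.pts l → D.mm l b = 1 ∨ D.mm l b = 2 ∨ D.mm l b = p) ∧
    #((D.thr P).filter fun l => D.mm l b = p) = p ∧
    #((D.thr P).filter fun l => D.mm l b = 2) ≤ 1 := by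
  have h7 : (7 : ℤ) ≤ p := by exact_mod_cast hp7
  obtain ⟨e1, e2, e3, e4, e5⟩ := D.two_counts hp7 he hb H hP
  have ht : ∀ l, P ∈ D.pts l → D.mm l b = 1 ∨ (D.mm l b = 2 ∧ D.k b l = 2) ∨ D.mm l b = p := by
    intro l hl
    have h1 := D.line_types hp7 he hb H hP hl
    have h2 := D.no_2p hp7 he hb H hP l
    tauto
  have hs1 : ∑ l ∈ D.thr P, (D.mm l b - 1) = p ^ 2 - p + D.E b := by
    rw [sum_sub_distrib, D.sum_mm, D.ind_self hP, sum_const, nsmul_eq_mul, D.card_thr, e4]; ring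
  have hs2 := D.sum_k1 b P
  rw [D.r_self hb hP] at hs2
  have hd : (#((D.thr P).filter fun l => D.mm l b = 2) : ℤ) ≤ D.E b := by
    rw [card_filter]; push_cast
    rw [show D.E b = D.E b + p * (1 - 1) by ring, ← hs2]
    apply sum_le_sum
    intro l hl
    have hk := (D.k_le_two hp7 he hb H hP (D.mem_thr.1 hl)).1
    have := ht l (D.mem_thr.1 hl)
    split_ifs with h <;> omega
  have hsplit : ∑ l ∈ D.thr P, (D.mm l b - 1) =
      (p - 1) * (#((D.thr P).filter fun l => D.mm l b = p) : ℤ)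
        + #((D.thr P).filter fun l => D.mm l b = 2) := by
    rw [card_filter, card_filter]; push_cast
    rw [mul_sum, ← sum_add_distrib]
    apply sum_congr rfl
    intro l hl
    rcases ht l (D.mem_thr.1 hl) with h | h | h
    · rw [if_neg (by omega), if_neg (by omega), h]; ring
    · rw [if_neg (by omega), if_pos (by omega), h.1]; ring
    · rw [if_pos h, if_neg (by omega), h]; ring
  refine ⟨fun l hl => by have := ht l hl; tauto, ?_, by omega⟩
  set a := #((D.thr P).filter fun l => D.mm l b = p)
  set d := #((D.thr P).filter fun l => D.mm l b = 2)
  have h0 : (0 : ℤ) ≤ d := by positivity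
  have h3 : ((p : ℤ) - 1) * (a - p) = D.E b - d := by linear_combination hs1 - hsplit
  have h4 : (a : ℤ) - p = 0 := by
    by_contra hne
    rcases lt_or_gt_of_ne hne with g | g
    · nlinarith
    · nlinarith
  omega

end PlaneCode

end

section
open Finset
namespace PlaneCode
variable {p : ℕ} {X Λ : Type} [Fintype X] [Fintype Λ] [DecidableEq X] [DecidableEq Λ]
variable (D : PlaneCode p X Λ)
variable [hp : Fact p.Prime]

/-- the points of value `b` on a line -/
def apt (b : ZMod p) (l : Λ) : Finset X := (D.pts l).filter fun x => D.c x = b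

lemma mem_apt {b : ZMod p} {l : Λ} {x : X} : x ∈ D.apt b l ↔ x ∈ D.pts l ∧ D.c x = b := by
  simp [apt]

lemma card_apt (b : ZMod p) (l : Λ) : (#(D.apt b l) : ℤ) = D.mm l b := by
  unfold apt mm ind
  rw [card_filter]; push_cast; rfl

lemma line_unique {x y : X} (h : x ≠ y) {l m : Λ} (h1 : x ∈ D.pts l) (h2 : y ∈ D.pts l)
    (h3 : x ∈ D.pts m) (h4 : y ∈ D.pts m) : l = m := by
  obtain ⟨l0, -, hu⟩ := D.line x y h
  exact (hu l ⟨h1, h2⟩).trans (hu m ⟨h3, h4⟩).symm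

/-- the structure of a set of points -/
def Str (b : ZMod p) : Prop := ∀ P, D.c P = b →
    (∀ l, P ∈ D.pts l → D.mm l b = 1 ∨ D.mm l b = 2 ∨ D.mm l b = p) ∧
    #((D.thr P).filter fun l => D.mm l b = p) = p ∧
    #((D.thr P).filter fun l => D.mm l b = 2) ≤ 1

/-- no two-secant joins `P` to a point of `l` -/
def Good (b : ZMod p) (P : X) (l : Λ) : Prop :=
  ∀ z ∈ D.pts l, D.c z = b → z ≠ P → ∀ t, P ∈ D.pts t → z ∈ D.pts t → D.mm t b ≠ 2

lemma two_le_mm {b : ZMod p} {x y : X} (h : x ≠ y) {t : Λ} (hx : x ∈ D.pts t) (hy : y ∈ D.pts t)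
    (cx : D.c x = b) (cy : D.c y = b) : 2 ≤ D.mm t b := by
  rw [← D.card_apt]
  have : 1 < #(D.apt b t) := one_lt_card.2 ⟨x, D.mem_apt.2 ⟨hx, cx⟩, y, D.mem_apt.2 ⟨hy, cy⟩, h⟩
  omega

lemma good_p {b : ZMod p} (hS : D.Str b) {P z : X} {l t : Λ} (hg : D.Good b P l)
    (hP : D.c P = b) (hz : D.c z = b) (hzP : z ≠ P) (hzl : z ∈ D.pts l) (h1 : P ∈ D.pts t)
    (h2 : z ∈ D.pts t) : D.mm t b = p := by
  have h := (hS P hP).1 t h1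
  have g := hg z hzl hz hzP t h1 h2
  have k := D.two_le_mm hzP h2 h1 hz hP
  omega

lemma good_meets {b : ZMod p} (hS : D.Str b) {P : X} {l : Λ} (hg : D.Good b P l)
    (hP : D.c P = b) (hPl : P ∉ D.pts l) (hl : D.mm l b = p) {t : Λ} (ht : P ∈ D.pts t)
    (htp : D.mm t b = p) : ∃ z ∈ D.pts l, D.c z = b ∧ z ∈ D.pts t := by
  have hne : ∀ z, z ∈ D.apt b l → z ≠ P := fun z hz h => hPl (h ▸ (D.mem_apt.1 hz).1)
  let g : X → Λ := fun z => if h : z ≠ P then (D.line z P h).choose else t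
  have hg1 : ∀ z, z ≠ P → z ∈ D.pts (g z) ∧ P ∈ D.pts (g z) := fun z hz => by
    have := (D.line z P hz).choose_spec.1
    simp only [g, dif_pos hz]; exact this
  have hinj : Set.InjOn g (D.apt b l) := by
    intro x hx y hy hxy
    have hx' := D.mem_apt.1 hx
    have hy' := D.mem_apt.1 hy
    by_contra hc
    have h1 := hg1 x (hne x hx)
    have h2 := hg1 y (hne y hy)
    rw [← hxy] at h2
    have := D.line_unique hc h1.1 h2.1 hx'.1 hy'.1
    exact hPl (this ▸ h1.2)
  have hsub : (D.apt b l).image g ⊆ (D.thr P).filter fun l => D.mm l b = p := by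
    intro m hm
    obtain ⟨x, hx, rfl⟩ := mem_image.1 hm
    have hx' := D.mem_apt.1 hx
    have h1 := hg1 x (hne x hx)
    exact mem_filter.2 ⟨D.mem_thr.2 h1.2,
      D.good_p hS hg hP hx'.2 (hne x hx) hx'.1 h1.2 h1.1⟩
  have hcard : #((D.apt b l).image g) = p := by
    rw [card_image_of_injOn hinj]
    have := D.card_apt b l
    omega
  have heq := eq_of_subset_of_card_le hsub (by rw [hcard, (hS P hP).2.1])
  have htm : t ∈ (D.apt b l).image g := by
    rw [heq]; exact mem_filter.2 ⟨D.mem_thr.2 ht, htp⟩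
  obtain ⟨z, hz, hzt⟩ := mem_image.1 htm
  have hz' := D.mem_apt.1 hz
  have hz2 := (hg1 z (hne z hz)).1
  rw [hzt] at hz2
  exact ⟨z, hz'.1, hz'.2, hz2⟩

open Classical in
lemma bad_le (hp7 : 7 ≤ p) {b : ZMod p} (hS : D.Str b) {O P : X} {N : Λ} (hO : D.c O = b)
    (hP : D.c P = b)
    (hON : O ∈ D.pts N) (hPN : P ∈ D.pts N) (hOP : O ≠ P) (hN : D.mm N b = p) :
    #((D.thr O).filter fun l => l ≠ N ∧ ¬ D.Good b P l) ≤ 1 := by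
  apply card_le_one.2
  intro l hl m hm
  obtain ⟨hOl, hlN, hl⟩ := mem_filter.1 hl
  obtain ⟨hOm, hmN, hm⟩ := mem_filter.1 hm
  have hOl := D.mem_thr.1 hOl
  have hOm := D.mem_thr.1 hOm
  unfold Good at hl hm
  push Not at hl hm
  obtain ⟨z, hz, cz, zP, t, ht1, ht2, ht3⟩ := hl
  obtain ⟨z', hz', cz', zP', t', ht1', ht2', ht3'⟩ := hm
  have htt : t = t' := card_le_one.1 (hS P hP).2.2 t
    (mem_filter.2 ⟨D.mem_thr.2 ht1, ht3⟩) t' (mem_filter.2 ⟨D.mem_thr.2 ht1', ht3'⟩)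
  subst htt
  have hzz : z = z' := by
    by_contra hc
    have : #({z, z', P} : Finset X) ≤ #(D.apt b t) := by
      apply card_le_card
      intro y hy
      simp only [mem_insert, mem_singleton] at hy
      rcases hy with rfl | rfl | rfl <;> exact D.mem_apt.2 ⟨by assumption, by assumption⟩
    rw [card_eq_three.2 ⟨z, z', P, hc, zP, zP', rfl⟩] at this
    have h2 := D.card_apt b t
    omega
  subst hzz
  have hzO : O ≠ z := by
    rintro rfl
    have := D.line_unique hOP ht2 ht1 hON hPN
    subst this
    omega
  exact D.line_unique hzO hOl hz hOm hz'

theorem secant_frame (hp7 : 7 ≤ p) {b : ZMod p} (hS : D.Str b) {O : X} (hO : D.c O = b) :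
    ∃ (P Q : X) (N L M : Λ), D.c P = b ∧ D.c Q = b ∧ O ≠ P ∧ O ≠ Q ∧ P ≠ Q ∧
      O ∈ D.pts N ∧ P ∈ D.pts N ∧ Q ∈ D.pts N ∧ O ∈ D.pts L ∧ O ∈ D.pts M ∧
      L ≠ M ∧ L ≠ N ∧ M ≠ N ∧ #(D.apt b L) = p ∧
      (∀ y ∈ D.pts L, D.c y = b → y ≠ O → ∀ t, P ∈ D.pts t → y ∈ D.pts t →
        ∃ z ∈ D.pts M, D.c z = b ∧ z ∈ D.pts t) ∧
      (∀ y ∈ D.pts M, D.c y = b → y ≠ O → ∀ t, Q ∈ D.pts t → y ∈ D.pts t →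
        ∃ z ∈ D.pts L, D.c z = b ∧ z ∈ D.pts t) := by
  classical
  have hc := (hS O hO).2.1
  obtain ⟨N, hN⟩ := card_pos.1 (show 0 < #((D.thr O).filter fun l => D.mm l b = p) by omega)
  obtain ⟨hON, hNp⟩ := mem_filter.1 hN
  have hON := D.mem_thr.1 hON
  have hNc : #(D.apt b N) = p := by have := D.card_apt b N; omega
  have h2 : 1 < #((D.apt b N).erase O) := by
    have := pred_card_le_card_erase (s := D.apt b N) (a := O); omega
  obtain ⟨P, hP, Q, hQ, hPQ⟩ := one_lt_card.1 h2
  obtain ⟨hPO, hP⟩ := mem_erase.1 hP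
  obtain ⟨hQO, hQ⟩ := mem_erase.1 hQ
  obtain ⟨hPN, hP⟩ := D.mem_apt.1 hP
  obtain ⟨hQN, hQ⟩ := D.mem_apt.1 hQ
  have bP := D.bad_le hp7 hS hO hP hON hPN hPO.symm hNp
  have bQ := D.bad_le hp7 hS hO hQ hON hQN hQO.symm hNp
  set B1 := (D.thr O).filter fun l => l ≠ N ∧ ¬ D.Good b P l
  set B2 := (D.thr O).filter fun l => l ≠ N ∧ ¬ D.Good b Q l
  set G := (D.thr O).filter fun l => D.mm l b = p
  have hcard : 1 < #(G \ ({N} ∪ (B1 ∪ B2))) := by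
    have h1 := le_card_sdiff ({N} ∪ (B1 ∪ B2)) G
    have h2 := card_union_le {N} (B1 ∪ B2)
    have h3 := card_union_le B1 B2
    rw [card_singleton] at h2
    omega
  obtain ⟨L, hL, M, hM, hLM⟩ := one_lt_card.1 hcard
  have key : ∀ l ∈ G \ ({N} ∪ (B1 ∪ B2)), O ∈ D.pts l ∧ D.mm l b = p ∧ l ≠ N ∧ D.Good b P l ∧
      D.Good b Q l ∧ P ∉ D.pts l ∧ Q ∉ D.pts l := by
    intro l hl
    simp only [G, B1, B2, mem_sdiff, mem_union, mem_singleton, mem_filter, D.mem_thr] at hl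
    have hlN : l ≠ N := by tauto
    have h1 : O ∈ D.pts l := by tauto
    refine ⟨h1, by tauto, hlN,
      by_contra fun hG => hl.2 (Or.inr (Or.inl ⟨h1, hlN, hG⟩)),
      by_contra fun hG => hl.2 (Or.inr (Or.inr ⟨h1, hlN, hG⟩)), fun h => hlN ?_, fun h => hlN ?_⟩
    · exact D.line_unique hPO h h1 hPN hON
    · exact D.line_unique hQO h h1 hQN hON
  obtain ⟨L1, L2, L3, L4, L5, L6, L7⟩ := key L hL
  obtain ⟨M1, M2, M3, M4, M5, M6, M7⟩ := key M hM
  refine ⟨P, Q, N, L, M, hP, hQ, hPO.symm, hQO.symm, hPQ, hON, hPN, hQN, L1, M1, hLM, L3, M3,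
    by have := D.card_apt b L; omega, ?_, ?_⟩
  · intro y hy cy _ t ht1 ht2
    exact D.good_meets hS M4 hP M6 M2 ht1
      (D.good_p hS L4 hP cy (fun h => L6 (h ▸ hy)) hy ht1 ht2)
  · intro y hy cy _ t ht1 ht2
    exact D.good_meets hS L5 hQ L7 L2 ht1
      (D.good_p hS M5 hQ cy (fun h => M7 (h ▸ hy)) hy ht1 ht2)

/-- the conclusion of the combinatorial part -/
theorem combinatorial (hp7 : 7 ≤ p) (he : D.e ≤ 2) (hc : ∃ x, D.c x ≠ 0) :
    ∃ (b : ZMod p) (O : X), D.c O = b ∧ D.Str b := by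
  obtain ⟨O, hO⟩ := hc
  refine ⟨D.c O, O, rfl, ?_⟩
  have H : ∀ x, D.c x = 0 ∨ D.c x = D.c O ∨ D.c x = -D.c O := by
    intro x
    by_cases hx : D.c x = 0
    · exact Or.inl hx
    · exact Or.inr (D.two_values hp7 he hO hx ⟨O, rfl⟩ ⟨x, rfl⟩)
  intro P hP
  exact D.structure_A hp7 he hO H hP

end PlaneCode

end

section
open Finset
section PGbasics
variable {F : Type} [Field F] [Fintype F]

noncomputable instance instFintypePGPoint : Fintype (PGPoint F) :=
  haveI : Finite (PGPoint F) := Subtype.finite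
  Fintype.ofFinite _
noncomputable instance instFintypePGLine : Fintype (PGLine F) :=
  haveI : Finite (PGLine F) := Subtype.finite
  Fintype.ofFinite _

lemma PGPoint.eq_span (P : PGPoint F) {v : Fin 3 → F} (hv : v ≠ 0) (h : v ∈ P.1) :
    P.1 = Submodule.span F {v} := by
  symm
  apply Submodule.eq_of_le_of_finrank_eq
  · rwa [Submodule.span_singleton_le_iff_mem]
  · rw [finrank_span_singleton hv, P.2]

lemma PGPoint.exists_vec (P : PGPoint F) : ∃ v : Fin 3 → F, v ≠ 0 ∧ v ∈ P.1 := by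
  have : P.1 ≠ ⊥ := fun h => by
    have h2 := P.2
    rw [h] at h2; simp at h2
  obtain ⟨v, hv, h0⟩ := Submodule.exists_mem_ne_zero_of_ne_bot this
  exact ⟨v, h0, hv⟩

/-- the point spanned by a vector -/
def mkpt (v : Fin 3 → F) (hv : v ≠ 0) : PGPoint F :=
  ⟨Submodule.span F {v}, finrank_span_singleton hv⟩

lemma mem_mkpt (v : Fin 3 → F) (hv : v ≠ 0) : v ∈ (mkpt v hv).1 :=
  Submodule.mem_span_singleton_self v

lemma PGPoint.eq_mkpt (P : PGPoint F) {v : Fin 3 → F} (hv : v ≠ 0) (h : v ∈ P.1) :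
    P = mkpt v hv := Subtype.ext (P.eq_span hv h)

lemma PGPoint.le_iff (P : PGPoint F) {v : Fin 3 → F} (hv : v ≠ 0) (h : v ∈ P.1)
    (W : Submodule F (Fin 3 → F)) : P.1 ≤ W ↔ v ∈ W := by
  rw [P.eq_span hv h, Submodule.span_singleton_le_iff_mem]

lemma PGPoint.smul_of_mem (P : PGPoint F) {v w : Fin 3 → F} (hv : v ≠ 0) (h : v ∈ P.1)
    (hw : w ∈ P.1) : ∃ a : F, a • v = w := by
  rw [P.eq_span hv h] at hw
  exact Submodule.mem_span_singleton.1 hw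

lemma PG_line (P Q : PGPoint F) (h : P ≠ Q) : ∃! l : PGLine F, P.1 ≤ l.1 ∧ Q.1 ≤ l.1 := by
  have hinf : P.1 ⊓ Q.1 = ⊥ := by
    by_contra hne
    obtain ⟨v, hv, h0⟩ := Submodule.exists_mem_ne_zero_of_ne_bot hne
    exact h ((P.eq_mkpt h0 hv.1).trans (Q.eq_mkpt h0 hv.2).symm)
  have hr := Submodule.finrank_sup_add_finrank_inf_eq P.1 Q.1
  rw [hinf, finrank_bot, P.2, Q.2] at hr
  refine ⟨⟨P.1 ⊔ Q.1, by omega⟩, ⟨le_sup_left, le_sup_right⟩, ?_⟩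
  rintro l ⟨h1, h2⟩
  apply Subtype.ext
  symm
  apply Submodule.eq_of_le_of_finrank_eq
  · exact sup_le h1 h2
  · rw [l.2]; show Module.finrank F ↥(P.1 ⊔ Q.1) = 2; omega

open Classical in
lemma PG_count (K : Type) [Field K] [Fintype K] [Algebra K F] (G : Finset (Fin 3 → F))
    (h0 : (0 : Fin 3 → F) ∉ G)
    (hs : ∀ a : K, a ≠ 0 → ∀ v ∈ G, algebraMap K F a • v ∈ G)
    (hpr : ∀ v ∈ G, ∀ w ∈ G, ∀ α : F, α • v = w → ∃ a : K, algebraMap K F a = α) :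
    #G = #(univ.filter fun P : PGPoint F => ∃ v ∈ G, v ∈ P.1) * (Fintype.card K - 1) := by
  have := card_mul_eq_card_mul (s := G)
    (t := univ.filter fun P : PGPoint F => ∃ v ∈ G, v ∈ P.1)
    (fun (v : Fin 3 → F) (P : PGPoint F) => v ∈ P.1) (m := 1) (n := Fintype.card K - 1) ?_ ?_
  · rwa [mul_one] at this
  · intro v hv
    have hv0 : v ≠ 0 := fun h => h0 (h ▸ hv)
    rw [card_eq_one]
    refine ⟨mkpt v hv0, ?_⟩
    ext P
    simp only [mem_bipartiteAbove, mem_filter, mem_univ, true_and, mem_singleton]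
    constructor
    · rintro ⟨_, h⟩; exact P.eq_mkpt hv0 h
    · rintro rfl; exact ⟨⟨v, hv, mem_mkpt v hv0⟩, mem_mkpt v hv0⟩
  · intro P hP
    obtain ⟨v, hv, hvP⟩ := (mem_filter.1 hP).2
    have hv0 : v ≠ 0 := fun h => h0 (h ▸ hv)
    have himg : bipartiteBelow (fun (v : Fin 3 → F) (P : PGPoint F) => v ∈ P.1) G P
        = (univ.erase (0 : K)).image fun a => algebraMap K F a • v := by
      ext w
      simp only [mem_bipartiteBelow, mem_image, mem_erase, mem_univ, and_true]
      constructor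
      · rintro ⟨hw, hwP⟩
        obtain ⟨α, hα⟩ := P.smul_of_mem hv0 hvP hwP
        obtain ⟨a, ha⟩ := hpr v hv w hw α hα
        refine ⟨a, ?_, by rw [ha, hα]⟩
        rintro rfl
        rw [map_zero] at ha
        rw [← ha, zero_smul] at hα
        exact h0 (hα ▸ hw)
      · rintro ⟨a, ha, rfl⟩
        exact ⟨hs a ha v hv, P.1.smul_mem _ hvP⟩
    rw [himg, card_image_of_injective, card_erase_of_mem (mem_univ _), card_univ]
    intro a a' h
    exact (algebraMap K F).injective (smul_left_injective F hv0 h)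

open Classical in
/-- points in a subspace -/
lemma PG_count_sub (W : Submodule F (Fin 3 → F)) :
    Fintype.card F ^ (Module.finrank F W)
      = #(univ.filter fun P : PGPoint F => P.1 ≤ W) * (Fintype.card F - 1) + 1 := by
  obtain ⟨G, hG⟩ : ∃ G, G = (univ.filter fun v => v ∈ W).erase 0 := ⟨_, rfl⟩
  have h := PG_count (F := F) F G (by simp [hG])
    (fun a ha v hv => by
      simp only [hG, mem_erase, mem_filter, mem_univ, true_and] at hv ⊢
      exact ⟨smul_ne_zero ha hv.1, W.smul_mem _ hv.2⟩)
    (fun v _ w _ α _ => ⟨α, rfl⟩)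
  have h1 : (univ.filter fun P : PGPoint F => ∃ v ∈ G, v ∈ P.1)
      = univ.filter fun P : PGPoint F => P.1 ≤ W := by
    ext P
    simp only [hG, mem_erase, mem_filter, mem_univ, true_and]
    constructor
    · rintro ⟨v, ⟨hv0, hvW⟩, hvP⟩; exact (P.le_iff hv0 hvP W).2 hvW
    · intro h
      obtain ⟨v, hv0, hvP⟩ := P.exists_vec
      exact ⟨v, ⟨hv0, h hvP⟩, hvP⟩
  rw [h1] at h
  rw [← h, hG, card_erase_of_mem (by simp)]
  have h2 : #(univ.filter fun v => v ∈ W) = Fintype.card F ^ (Module.finrank F W) := by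
    rw [← Module.card_eq_pow_finrank (K := F) (V := W), Fintype.card_subtype]
  have h3 : 0 < Fintype.card F ^ (Module.finrank F W) := pow_pos Fintype.card_pos _
  omega

open Classical in
lemma PG_card_line (l : PGLine F) :
    #(univ.filter fun P : PGPoint F => P.1 ≤ l.1) = Fintype.card F + 1 := by
  have h := PG_count_sub l.1
  rw [l.2] at h
  have h2 : 1 < Fintype.card F := Fintype.one_lt_card
  obtain ⟨q, hq⟩ : ∃ q, Fintype.card F = q + 1 := ⟨_, (Nat.succ_pred_eq_of_pos (by omega)).symm⟩
  rw [hq] at h ⊢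
  rw [Nat.add_sub_cancel] at h
  have hq0 : 0 < q := by omega
  apply Nat.eq_of_mul_eq_mul_right hq0
  nlinarith

open Classical in
lemma PG_card_pts :
    Fintype.card (PGPoint F) = Fintype.card F ^ 2 + Fintype.card F + 1 := by
  have h := PG_count_sub (F := F) ⊤
  rw [finrank_top, Module.finrank_fin_fun] at h
  simp only [le_top, filter_true, card_univ] at h
  have h2 : 1 < Fintype.card F := Fintype.one_lt_card
  obtain ⟨q, hq⟩ : ∃ q, Fintype.card F = q + 1 := ⟨_, (Nat.succ_pred_eq_of_pos (by omega)).symm⟩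
  rw [hq] at h ⊢
  rw [Nat.add_sub_cancel] at h
  have hq0 : 0 < q := by omega
  apply Nat.eq_of_mul_eq_mul_right hq0
  nlinarith

open Classical in
lemma PG_card_thr (P : PGPoint F) :
    #(univ.filter fun l : PGLine F => P.1 ≤ l.1) = Fintype.card F + 1 := by
  have h := card_mul_eq_card_mul (s := (univ : Finset (PGPoint F)).erase P)
    (t := univ.filter fun l : PGLine F => P.1 ≤ l.1)
    (fun (Q : PGPoint F) (l : PGLine F) => Q.1 ≤ l.1) (m := 1) (n := Fintype.card F) ?_ ?_
  · rw [card_erase_of_mem (mem_univ _), card_univ, PG_card_pts] at h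
    apply Nat.eq_of_mul_eq_mul_right (Fintype.card_pos (α := F))
    rw [← h, Nat.add_sub_cancel]; ring
  · intro Q hQ
    obtain ⟨l, hl, hu⟩ := PG_line Q P (ne_of_mem_erase hQ)
    rw [card_eq_one]
    refine ⟨l, ?_⟩
    ext m
    simp only [mem_bipartiteAbove, mem_filter, mem_univ, true_and, mem_singleton]
    constructor
    · rintro ⟨h1, h2⟩; exact hu m ⟨h2, h1⟩
    · rintro rfl; exact ⟨hl.2, hl.1⟩
  · intro l hl
    have h1 := PG_card_line l
    have h2 : bipartiteBelow (fun (Q : PGPoint F) (l : PGLine F) => Q.1 ≤ l.1) (univ.erase P) l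
        = (univ.filter fun P : PGPoint F => P.1 ≤ l.1).erase P := by
      ext Q
      simp [mem_bipartiteBelow]
    rw [h2, card_erase_of_mem, h1, Nat.add_sub_cancel]
    simpa using hl

lemma finsum_line {p : ℕ} (c : PGPoint F → ZMod p) (s : Set (PGPoint F)) [DecidablePred (· ∈ s)] :
    ∑ᶠ x ∈ s, c x = ∑ x ∈ univ.filter (· ∈ s), c x := by
  rw [finsum_mem_eq_finite_toFinset_sum _ (Set.toFinite s)]
  apply sum_congr _ (fun _ _ => rfl)
  ext; simp

end PGbasics

end

section
open Finset
section PGlower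
variable {F : Type} [Field F] [Fintype F]

lemma lines_meet (U W : Submodule F (Fin 3 → F)) (hU : Module.finrank F U = 2)
    (hW : Module.finrank F W = 2) : ∃ v, v ≠ 0 ∧ v ∈ U ∧ v ∈ W := by
  have h := Submodule.finrank_sup_add_finrank_inf_eq U W
  have h2 := Submodule.finrank_le (U ⊔ W)
  rw [Module.finrank_fin_fun] at h2
  have hne : U ⊓ W ≠ ⊥ := fun hb => by
    rw [hb, finrank_bot] at h; omega
  obtain ⟨v, hv, h0⟩ := Submodule.exists_mem_ne_zero_of_ne_bot hne
  exact ⟨v, h0, hv.1, hv.2⟩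

lemma pt_eq {P Q : PGPoint F} {v : Fin 3 → F} (hv : v ≠ 0) (h1 : v ∈ P.1) (h2 : v ∈ Q.1) :
    P = Q := (P.eq_mkpt hv h1).trans (Q.eq_mkpt hv h2).symm

lemma line_comb (l : PGLine F) {P Q : PGPoint F} (hne : P ≠ Q) (hP : P.1 ≤ l.1) (hQ : Q.1 ≤ l.1)
    {o v w : Fin 3 → F} (ho : o ≠ 0) (hv : v ≠ 0) (h1 : o ∈ P.1) (h2 : v ∈ Q.1) (hw : w ∈ l.1) :
    ∃ a b : F, w = a • o + b • v := by
  have hl : l.1 = P.1 ⊔ Q.1 := by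
    obtain ⟨m, hm, hu⟩ := PG_line P Q hne
    have hinf : P.1 ⊓ Q.1 = ⊥ := by
      by_contra hc
      obtain ⟨v, hv, h0⟩ := Submodule.exists_mem_ne_zero_of_ne_bot hc
      exact hne (pt_eq h0 hv.1 hv.2)
    have hr := Submodule.finrank_sup_add_finrank_inf_eq P.1 Q.1
    rw [hinf, finrank_bot, P.2, Q.2] at hr
    symm
    apply Submodule.eq_of_le_of_finrank_eq (sup_le hP hQ)
    rw [l.2]; omega
  rw [hl] at hw
  obtain ⟨y, hy, z, hz, rfl⟩ := Submodule.mem_sup.1 hw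
  obtain ⟨a, rfl⟩ := P.smul_of_mem ho h1 hy
  obtain ⟨b, rfl⟩ := Q.smul_of_mem hv h2 hz
  exact ⟨a, b, rfl⟩

lemma mem_of_smul {W : Submodule F (Fin 3 → F)} {a : F} (ha : a ≠ 0) {v : Fin 3 → F}
    (h : a • v ∈ W) : v ∈ W := (Submodule.smul_mem_iff W ha).1 h

lemma PG_line_eq {P Q : PGPoint F} (h : P ≠ Q) {l m : PGLine F} (h1 : P.1 ≤ l.1) (h2 : Q.1 ≤ l.1)
    (h3 : P.1 ≤ m.1) (h4 : Q.1 ≤ m.1) : l = m := by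
  obtain ⟨l0, -, hu⟩ := PG_line P Q h
  exact (hu l ⟨h1, h2⟩).trans (hu m ⟨h3, h4⟩).symm

open Classical in
theorem PG_config_false {p : ℕ} (hp : p.Prime) [CharP F p] (A : PGPoint F → Prop)
    (O P Q : PGPoint F) (N L M : PGLine F) (hAO : A O) (hOP : O ≠ P) (hOQ : O ≠ Q) (hPQ : P ≠ Q)
    (hON : O.1 ≤ N.1) (hPN : P.1 ≤ N.1) (hQN : Q.1 ≤ N.1) (hOL : O.1 ≤ L.1) (hOM : O.1 ≤ M.1)
    (hLM : L ≠ M) (hLN : L ≠ N) (hMN : M ≠ N)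
    (hcard : #(univ.filter fun R : PGPoint F => R.1 ≤ L.1 ∧ A R) = p)
    (h1 : ∀ y : PGPoint F, y.1 ≤ L.1 → A y → y ≠ O → ∀ t : PGLine F, P.1 ≤ t.1 → y.1 ≤ t.1 →
      ∃ z : PGPoint F, z.1 ≤ M.1 ∧ A z ∧ z.1 ≤ t.1)
    (h2 : ∀ y : PGPoint F, y.1 ≤ M.1 → A y → y ≠ O → ∀ t : PGLine F, Q.1 ≤ t.1 → y.1 ≤ t.1 →
      ∃ z : PGPoint F, z.1 ≤ L.1 ∧ A z ∧ z.1 ≤ t.1) : False := by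
  -- choose coordinates
  obtain ⟨o0, ho0, ho0O⟩ := O.exists_vec
  obtain ⟨x, hx0, hxP⟩ := P.exists_vec
  obtain ⟨q, hq0, hqQ⟩ := Q.exists_vec
  obtain ⟨a, b, hq⟩ := line_comb N hOP hON hPN ho0 hx0 ho0O hxP (hQN hqQ)
  have hb : b ≠ 0 := by
    rintro rfl
    rw [zero_smul, add_zero] at hq
    exact hOQ (pt_eq hq0 (hq ▸ O.1.smul_mem a ho0O) hqQ)
  have ha : a ≠ 0 := by
    rintro rfl
    rw [zero_smul, zero_add] at hq
    exact hPQ (pt_eq hq0 (hq ▸ P.1.smul_mem b hxP) hqQ)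
  obtain ⟨o, ho⟩ : ∃ o, o = (b⁻¹ * a) • o0 := ⟨_, rfl⟩
  have hoO : o ∈ O.1 := ho ▸ O.1.smul_mem _ ho0O
  have hon : o ≠ 0 := ho ▸ smul_ne_zero (mul_ne_zero (inv_ne_zero hb) ha) ho0
  have hxoQ : x + o ∈ Q.1 := by
    have : x + o = b⁻¹ • q := by
      rw [hq, ho, smul_add, smul_smul, smul_smul, inv_mul_cancel₀ hb, one_smul, add_comm]
    rw [this]; exact Q.1.smul_mem _ hqQ
  have hxo0 : x + o ≠ 0 := by
    intro h
    exact hOP (pt_eq hx0 (by rw [eq_neg_of_add_eq_zero_left h]; exact O.1.neg_mem hoO) hxP)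
  -- a further point of M
  obtain ⟨Z, hZM, hZO⟩ : ∃ Z : PGPoint F, Z.1 ≤ M.1 ∧ Z ≠ O := by
    have hc := PG_card_line M
    have h3 : 1 < #(univ.filter fun R : PGPoint F => R.1 ≤ M.1) := by
      rw [hc]; have := Fintype.card_pos (α := F); omega
    obtain ⟨Z, hZ, hne⟩ := exists_mem_ne h3 O
    exact ⟨Z, (mem_filter.1 hZ).2, hne⟩
  have hPM : ¬ P.1 ≤ M.1 := fun h => hMN (PG_line_eq hOP hOM h hON hPN)
  have hPL : ¬ P.1 ≤ L.1 := fun h => hLN (PG_line_eq hOP hOL h hON hPN)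
  have hZL : ¬ Z.1 ≤ L.1 := fun h => hLM (PG_line_eq hZO h hOL hZM hOM)
  have hPZ : P ≠ Z := fun h => hPM (h ▸ hZM)
  obtain ⟨u0, hu00, hu0Z⟩ := Z.exists_vec
  obtain ⟨K, ⟨hPK, hZK⟩, -⟩ := PG_line P Z hPZ
  obtain ⟨v, hv0, hvL, hvK⟩ := lines_meet L.1 K.1 L.2 K.2
  obtain ⟨b', c', hv⟩ := line_comb K hPZ hPK hZK hx0 hu00 hxP hu0Z hvK
  have hb' : b' ≠ 0 := by
    rintro rfl
    rw [zero_smul, zero_add] at hv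
    exact hZL ((Z.le_iff hv0 (hv ▸ Z.1.smul_mem _ hu0Z) _).2 hvL)
  have hc' : c' ≠ 0 := by
    rintro rfl
    rw [zero_smul, add_zero] at hv
    exact hPL ((P.le_iff hv0 (hv ▸ P.1.smul_mem _ hxP) _).2 hvL)
  obtain ⟨u, hu⟩ : ∃ u, u = (b'⁻¹ * c') • u0 := ⟨_, rfl⟩
  have huZ : u ∈ Z.1 := hu ▸ Z.1.smul_mem _ hu0Z
  have hun : u ≠ 0 := hu ▸ smul_ne_zero (mul_ne_zero (inv_ne_zero hb') hc') hu00
  have hxuL : x + u ∈ L.1 := by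
    have : x + u = b'⁻¹ • v := by
      rw [hv, hu, smul_add, smul_smul, smul_smul, inv_mul_cancel₀ hb', one_smul]
    rw [this]; exact L.1.smul_mem _ hvL
  -- independence
  have hind : ∀ α β γ : F, α • o + β • x + γ • u = 0 → α = 0 ∧ β = 0 ∧ γ = 0 := by
    intro α β γ h
    have hβ : β = 0 := by
      by_contra hβ
      have : β • x ∈ M.1 := by
        have e : β • x = -(α • o) - γ • u := by
          rw [← sub_eq_zero, ← h]; abel
        rw [e]
        exact M.1.sub_mem (M.1.neg_mem (M.1.smul_mem _ (hOM hoO))) (M.1.smul_mem _ (hZM huZ))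
      exact hPM ((P.le_iff hx0 hxP _).2 (mem_of_smul hβ this))
    rw [hβ, zero_smul, add_zero] at h
    have hγ : γ = 0 := by
      by_contra hγ
      have : γ • u ∈ O.1 := by
        rw [eq_neg_of_add_eq_zero_right h]
        exact O.1.neg_mem (O.1.smul_mem _ hoO)
      exact hZO (pt_eq hun huZ (mem_of_smul hγ this))
    rw [hγ, zero_smul, add_zero] at h
    exact ⟨(smul_eq_zero.1 h).resolve_right hon, hβ, hγ⟩
  have hLn : ∀ l : F, x + u + l • o ≠ 0 := fun l h => by
    have := hind l 1 1 (by rw [← h]; module)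
    exact one_ne_zero this.2.1
  have hxu0 : x + u ≠ 0 := fun h => hLn 0 (by rw [h]; simp)
  have hLmem : ∀ l : F, x + u + l • o ∈ L.1 := fun l =>
    L.1.add_mem hxuL (L.1.smul_mem _ (hOL hoO))
  have hLnO : ∀ l : F, x + u + l • o ∉ O.1 := fun l h => by
    obtain ⟨α, hα⟩ := O.smul_of_mem hon hoO h
    have := hind (l - α) 1 1 (by
      rw [sub_smul, hα]; module)
    exact one_ne_zero this.2.1
  have hLcomb : ∀ w ∈ L.1, ∃ α β : F, w = α • o + β • (x + u) := fun w hw => by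
    have hne : O ≠ mkpt (x + u) hxu0 := fun h => hLnO 0 (by
      rw [zero_smul, add_zero, h]; exact mem_mkpt _ _)
    exact line_comb L hne hOL ((PGPoint.le_iff _ hxu0 (mem_mkpt _ _) _).2 hxuL) hon hxu0 hoO
      (mem_mkpt _ _) hw
  -- the parameter set
  obtain ⟨S, hS⟩ : ∃ S : Finset F, S = univ.filter fun l : F =>
      ∃ R : PGPoint F, A R ∧ x + u + l • o ∈ R.1 := ⟨_, rfl⟩
  have hScard : #S = p - 1 := by
    rw [← hcard, ← card_erase_of_mem (a := O) (by simp [hOL, hAO])]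
    apply card_bij (fun l _ => mkpt (x + u + l • o) (hLn l))
    · intro l hl
      simp only [hS, mem_filter, mem_univ, true_and] at hl
      obtain ⟨R, hR, hRm⟩ := hl
      rw [← R.eq_mkpt (hLn l) hRm]
      simp only [mem_erase, mem_filter, mem_univ, true_and]
      refine ⟨?_, (R.le_iff (hLn l) hRm _).2 (hLmem l), hR⟩
      rintro rfl; exact hLnO l hRm
    · intro l _ m _ h
      have hm := mem_mkpt (x + u + m • o) (hLn m)
      rw [← h] at hm
      obtain ⟨α, hα⟩ := PGPoint.smul_of_mem _ (hLn l) (mem_mkpt _ (hLn l)) hm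
      have := hind (α * l - m) (α - 1) (α - 1) (by
        rw [← sub_eq_zero] at hα
        rw [← hα]; module)
      have h1 : α = 1 := sub_eq_zero.1 this.2.1
      rw [h1, one_mul] at this
      exact sub_eq_zero.1 this.1
    · intro R hR
      simp only [mem_erase, mem_filter, mem_univ, true_and] at hR
      obtain ⟨hRO, hRL, hRA⟩ := hR
      obtain ⟨w, hw0, hwR⟩ := R.exists_vec
      obtain ⟨α, β, hw⟩ := hLcomb w (hRL hwR)
      have hβ : β ≠ 0 := by
        rintro rfl
        rw [zero_smul, add_zero] at hw
        exact hRO (pt_eq hw0 hwR (hw ▸ O.1.smul_mem _ hoO))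
      have hmem : x + u + (β⁻¹ * α) • o ∈ R.1 := by
        apply mem_of_smul hβ
        have : β • (x + u + (β⁻¹ * α) • o) = w := by
          rw [hw, smul_add, smul_smul, ← mul_assoc, mul_inv_cancel₀ hβ, one_mul, add_comm]
        rwa [this]
      refine ⟨β⁻¹ * α, ?_, ?_⟩
      · simp only [hS, mem_filter, mem_univ, true_and]
        exact ⟨R, hRA, hmem⟩
      · exact (R.eq_mkpt _ hmem).symm
  have hstep : ∀ l ∈ S, l + 1 ∈ S := by
    intro l hl
    simp only [hS, mem_filter, mem_univ, true_and] at hl ⊢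
    obtain ⟨R, hRA, hR⟩ := hl
    have hRO : R ≠ O := by rintro rfl; exact hLnO l hR
    have hRL : R.1 ≤ L.1 := (R.le_iff (hLn l) hR _).2 (hLmem l)
    have hPR : P ≠ R := by rintro rfl; exact hPL hRL
    obtain ⟨t, ⟨hPt, hRt⟩, -⟩ := PG_line P R hPR
    obtain ⟨z, hzM, hzA, hzt⟩ := h1 R hRL hRA hRO t hPt hRt
    obtain ⟨w, hw0, hwz⟩ := z.exists_vec
    obtain ⟨α, β, hw1⟩ := line_comb M hZO.symm hOM hZM hon hun hoO huZ (hzM hwz)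
    obtain ⟨γ, δ, hw2⟩ := line_comb t hPR hPt hRt hx0 (hLn l) hxP hR (hzt hwz)
    have hi := hind (α - δ * l) (-γ - δ) (β - δ) (by
      have := sub_eq_zero.2 (hw1.symm.trans hw2)
      rw [← this]; module)
    have hα : α = δ * l := sub_eq_zero.1 hi.1
    have hβ : β = δ := sub_eq_zero.1 hi.2.2
    rw [hα, hβ] at hw1
    have hδ : δ ≠ 0 := by
      rintro rfl
      apply hw0; rw [hw1]; simp
    have hul : u + l • o ∈ z.1 := by
      apply mem_of_smul hδ
      have : δ • (u + l • o) = w := by rw [hw1]; module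
      rwa [this]
    have hul0 : u + l • o ≠ 0 := fun h => by
      have := hind l 0 1 (by rw [← h]; module)
      exact one_ne_zero this.2.2
    have hzO : z ≠ O := by
      rintro rfl
      obtain ⟨α, hα⟩ := z.smul_of_mem hon hoO hul
      have := hind (l - α) 0 1 (by rw [sub_smul, hα]; module)
      exact one_ne_zero this.2.2
    have hQz : Q ≠ z := by
      rintro rfl
      exact hMN (PG_line_eq hOQ hOM hzM hON hQN)
    obtain ⟨t', ⟨hQt, hzt'⟩, -⟩ := PG_line Q z hQz
    obtain ⟨y, hyL, hyA, hyt⟩ := h2 z hzM hzA hzO t' hQt hzt'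
    obtain ⟨w', hw0', hwy⟩ := y.exists_vec
    obtain ⟨α', β', hw1'⟩ := hLcomb w' (hyL hwy)
    obtain ⟨γ', δ', hw2'⟩ := line_comb t' hQz hQt hzt' hxo0 hul0 hxoQ hul (hyt hwy)
    have hi' := hind (α' - γ' - δ' * l) (β' - γ') (β' - δ') (by
      have := sub_eq_zero.2 (hw1'.symm.trans hw2')
      rw [← this]; module)
    have e1 : γ' = β' := (sub_eq_zero.1 hi'.2.1).symm
    have e2 : δ' = β' := (sub_eq_zero.1 hi'.2.2).symm
    have e3 : α' = β' * (l + 1) := by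
      have := hi'.1
      rw [e1, e2] at this
      linear_combination this
    rw [e3] at hw1'
    have hβ' : β' ≠ 0 := by
      rintro rfl
      apply hw0'; rw [hw1']; simp
    refine ⟨y, hyA, ?_⟩
    apply mem_of_smul hβ'
    have : β' • (x + u + (l + 1) • o) = w' := by rw [hw1']; module
    rwa [this]
  have himg : S.image (· + 1) = S := by
    apply eq_of_subset_of_card_le
    · intro l hl
      obtain ⟨m, hm, rfl⟩ := mem_image.1 hl
      exact hstep m hm
    · rw [card_image_of_injective _ (add_left_injective 1)]
  have hsum : ∑ l ∈ S, l = ∑ l ∈ S, (l + 1) := by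
    conv_lhs => rw [← himg]
    rw [sum_image fun a _ b _ h => add_left_injective 1 h]
  rw [sum_add_distrib, sum_const, nsmul_eq_mul, mul_one, left_eq_add, hScard,
    CharP.cast_eq_zero_iff F p] at hsum
  have h3 := hp.two_le
  have := Nat.le_of_dvd (by omega) hsum
  omega

end PGlower

end

section
open Finset
section PGfinal
variable {F : Type} [Field F] [Fintype F]

noncomputable instance instDecPGPoint : DecidableEq (PGPoint F) := Classical.decEq _
noncomputable instance instDecPGLine : DecidableEq (PGLine F) := Classical.decEq _

open Classical in
/-- the abstract plane code of a code word of the dual code -/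
noncomputable def pgCode {p : ℕ} (hF : Fintype.card F = p ^ 2) (c : PGPoint F → ZMod p)
    (hc : IsDualCodeWord p (PGIncidence F) c) : PlaneCode p (PGPoint F) (PGLine F) where
  pts l := univ.filter fun P => P.1 ≤ l.1
  line x y h := by
    simp only [mem_filter, mem_univ, true_and]
    exact PG_line x y h
  cardlines x := by
    simp only [mem_filter, mem_univ, true_and]
    rw [← hF]
    convert PG_card_thr x
  c := c
  zero l := by
    have h := hc l
    rw [finsum_line] at h
    rw [← h]
    apply sum_congr _ (fun _ _ => rfl)
    ext x
    simp only [mem_filter, mem_univ, true_and]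
    exact Iff.rfl

theorem PG_lower {p : ℕ} (hp : p.Prime) (hp7 : 7 ≤ p) (hF : Fintype.card F = p ^ 2)
    (c : PGPoint F → ZMod p) (hc : IsDualCodeWord p (PGIncidence F) c) (h0 : c ≠ 0) :
    2 * p ^ 2 - 2 * p + 5 ≤ (Function.support c).ncard := by
  classical
  by_contra! hlt
  have : Fact p.Prime := ⟨hp⟩
  have : CharP F p := charP_of_card_eq_prime_pow (f := 2) (by rw [hF])
  set D := pgCode hF c hc with hD
  have hDc : D.c = c := rfl
  have hw : D.w = (Function.support c).ncard := by
    have : Function.support c = ((univ.filter fun x => c x ≠ 0 : Finset (PGPoint F)) : Set _) := by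
      ext; simp
    rw [this, Set.ncard_coe_finset, card_filter]
    unfold PlaneCode.w PlaneCode.sup
    push_cast
    apply sum_congr rfl
    intro x _
    rw [hDc]
    by_cases h : c x = 0 <;> simp [h]
  have he : D.e ≤ 2 := by
    unfold PlaneCode.e
    rw [hw]
    have h1 : 2 * p ≤ 2 * p ^ 2 := by nlinarith
    have h2 : ((Function.support c).ncard : ℤ) < 2 * p ^ 2 - 2 * p + 5 := by
      have : ((Function.support c).ncard : ℤ) < ((2 * p ^ 2 - 2 * p + 5 : ℕ) : ℤ) := by
        exact_mod_cast hlt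
      push_cast [h1] at this
      exact this
    linarith
  obtain ⟨x0, hx0⟩ := Function.ne_iff.1 h0
  obtain ⟨b, O, hO, hS⟩ := D.combinatorial hp7 he ⟨x0, hx0⟩
  obtain ⟨P, Q, N, L, M, hP, hQ, hOP, hOQ, hPQ, hON, hPN, hQN, hOL, hOM, hLM, hLN, hMN, hcard, h1,
    h2⟩ := D.secant_frame hp7 hS hO
  have hm : ∀ (x : PGPoint F) (l : PGLine F), x ∈ D.pts l ↔ x.1 ≤ l.1 := by
    intro x l
    simp [hD, pgCode]
  simp only [hm] at hON hPN hQN hOL hOM h1 h2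
  refine PG_config_false hp (fun x => c x = b) O P Q N L M hO hOP hOQ hPQ hON hPN hQN hOL hOM
    hLM hLN hMN ?_ h1 h2
  refine (congrArg card (Finset.ext fun x => ?_)).trans hcard
  rw [D.mem_apt, hm, hDc]
  simp only [mem_filter, mem_univ, true_and]

/-- coordinatewise embedding of prime field vectors -/
def emb (p : ℕ) [Fact p.Prime] [Algebra (ZMod p) F] (v : Fin 3 → ZMod p) : Fin 3 → F :=
  fun i => algebraMap (ZMod p) F (v i)

variable {p : ℕ} [hp : Fact p.Prime] [Algebra (ZMod p) F]

lemma emb_inj : Function.Injective (emb (F := F) p) := by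
  intro v w h
  ext1 i
  exact (algebraMap (ZMod p) F).injective (congrFun h i)

lemma emb_zero : emb (F := F) p 0 = 0 := by ext; simp [emb]

lemma emb_smul (a : ZMod p) (v : Fin 3 → ZMod p) :
    emb (F := F) p (a • v) = algebraMap (ZMod p) F a • emb p v := by
  ext; simp [emb]

/-- Baer points -/
def Baer (p : ℕ) [Fact p.Prime] [Algebra (ZMod p) F] (P : PGPoint F) : Prop :=
  ∃ v : Fin 3 → ZMod p, v ≠ 0 ∧ emb p v ∈ P.1

open Classical in
lemma Baer_count (W : Submodule F (Fin 3 → F)) :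
    #(univ.filter fun v : Fin 3 → ZMod p => emb p v ∈ W)
      = #(univ.filter fun P : PGPoint F => Baer p P ∧ P.1 ≤ W) * (p - 1) + 1 := by
  obtain ⟨G, hG⟩ : ∃ G : Finset (Fin 3 → F), G = ((univ.filter fun v : Fin 3 → ZMod p =>
    emb p v ∈ W).erase 0).image (emb p) := ⟨_, rfl⟩
  have hmem : ∀ w, w ∈ G ↔ ∃ v : Fin 3 → ZMod p, v ≠ 0 ∧ emb p v ∈ W ∧ emb p v = w := by
    intro w
    simp [hG, and_assoc]
  have h := PG_count (F := F) (ZMod p) G ?_ ?_ ?_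
  · have h1 : (univ.filter fun P : PGPoint F => ∃ v ∈ G, v ∈ P.1)
        = univ.filter fun P : PGPoint F => Baer p P ∧ P.1 ≤ W := by
      ext P
      simp only [hmem, mem_filter, mem_univ, true_and]
      constructor
      · rintro ⟨w, ⟨v, hv0, hvW, rfl⟩, hwP⟩
        refine ⟨⟨v, hv0, hwP⟩, (P.le_iff ?_ hwP _).2 hvW⟩
        rw [← emb_zero (p := p)]; exact fun h => hv0 (emb_inj h)
      · rintro ⟨⟨v, hv0, hvP⟩, hPW⟩
        exact ⟨emb p v, ⟨v, hv0, hPW hvP, rfl⟩, hvP⟩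
    have hz : (0 : Fin 3 → ZMod p) ∈ univ.filter fun v : Fin 3 → ZMod p => emb p v ∈ W := by
      simp [emb_zero]
    rw [h1, ZMod.card] at h
    rw [← h, hG, card_image_of_injective _ emb_inj, card_erase_of_mem hz]
    have := card_pos.2 ⟨_, hz⟩
    omega
  · rw [hmem]
    rintro ⟨v, hv0, _, hv⟩
    rw [← emb_zero (p := p)] at hv
    exact hv0 (emb_inj hv)
  · intro a ha w hw
    obtain ⟨v, hv0, hvW, rfl⟩ := (hmem w).1 hw
    rw [hmem]
    refine ⟨a • v, smul_ne_zero ha hv0, ?_, emb_smul a v⟩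
    rw [emb_smul]; exact W.smul_mem _ hvW
  · intro v' hv' w' hw' α hα
    obtain ⟨v, hv0, -, rfl⟩ := (hmem v').1 hv'
    obtain ⟨w, hw0, -, rfl⟩ := (hmem w').1 hw'
    obtain ⟨i, hi⟩ := Function.ne_iff.1 hv0
    refine ⟨w i * (v i)⁻¹, ?_⟩
    have h := congrFun hα i
    simp only [Pi.smul_apply, emb, smul_eq_mul] at h
    have hne : algebraMap (ZMod p) F (v i) ≠ 0 := (map_ne_zero _).2 hi
    rw [map_mul, map_inv₀, ← h, mul_assoc, mul_inv_cancel₀ hne, mul_one]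

lemma mod_one {a q n : ℕ} (h1 : 1 ≤ q) (hpq : p ∣ q) (h : n = a * (q - 1) + 1) (hd : p ∣ n) :
    ((a : ℕ) : ZMod p) = 1 := by
  have h2 : ((n : ℕ) : ZMod p) = 0 := (ZMod.natCast_eq_zero_iff _ _).2 hd
  have h3 : ((q : ℕ) : ZMod p) = 0 := (ZMod.natCast_eq_zero_iff _ _).2 hpq
  rw [h] at h2
  push_cast [h1] at h2
  rw [h3] at h2
  linear_combination -h2

open Classical in
lemma Baer_line (hF : Fintype.card F = p ^ 2) (m : PGLine F) :
    ((#(univ.filter fun P : PGPoint F => Baer p P ∧ P.1 ≤ m.1) : ℕ) : ZMod p) = 1 := by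
  refine mod_one hp.out.one_le (dvd_refl p) (Baer_count m.1) ?_
  let H : AddSubgroup (Fin 3 → ZMod p) :=
    { carrier := {v | emb p v ∈ m.1}
      zero_mem' := by simp [emb_zero]
      add_mem' := by
        intro a b ha hb
        have : emb (F := F) p (a + b) = emb p a + emb p b := by ext; simp [emb]
        simp only [Set.mem_setOf_eq] at *
        rw [this]; exact m.1.add_mem ha hb
      neg_mem' := by
        intro a ha
        have : emb (F := F) p (-a) = - emb p a := by ext; simp [emb]
        simp only [Set.mem_setOf_eq] at *
        rw [this]; exact m.1.neg_mem ha }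
  have hH : #(univ.filter fun v : Fin 3 → ZMod p => emb p v ∈ m.1) = Nat.card H := by
    rw [Nat.card_eq_fintype_card, Fintype.card_subtype]
    congr 1
  rw [hH]
  have hdvd := AddSubgroup.card_addSubgroup_dvd_card H
  rw [Nat.card_eq_fintype_card (α := Fin 3 → ZMod p), Fintype.card_fun, ZMod.card,
    Fintype.card_fin] at hdvd
  obtain ⟨k, -, hk⟩ := (Nat.dvd_prime_pow hp.out).1 hdvd
  rw [hk]
  apply dvd_pow_self
  rintro rfl
  rw [pow_zero, AddSubgroup.card_eq_one] at hk
  -- pigeonhole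
  have hq : Fintype.card ((Fin 3 → F) ⧸ m.1) = p ^ 2 := by
    have h1 := Submodule.finrank_quotient_add_finrank m.1
    rw [m.2, Module.finrank_fin_fun] at h1
    rw [Module.card_eq_pow_finrank (K := F), show Module.finrank F ((Fin 3 → F) ⧸ m.1) = 1 by omega,
      hF, pow_one]
  obtain ⟨v, w, hvw, h⟩ := Fintype.exists_ne_map_eq_of_card_lt
    (fun v : Fin 3 → ZMod p => m.1.mkQ (emb p v)) (by
      rw [hq, Fintype.card_fun, ZMod.card, Fintype.card_fin]
      exact Nat.pow_lt_pow_right hp.out.one_lt (by norm_num))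
  have hsub : v - w ∈ H := by
    show emb p (v - w) ∈ m.1
    have : emb (F := F) p (v - w) = emb p v - emb p w := by ext; simp [emb]
    rw [this]
    simpa [Submodule.Quotient.eq] using h
  rw [hk, AddSubgroup.mem_bot, sub_eq_zero] at hsub
  exact hvw hsub

open Classical in
lemma line_line (hF : Fintype.card F = p ^ 2) (l m : PGLine F) :
    ((#(univ.filter fun P : PGPoint F => P.1 ≤ l.1 ∧ P.1 ≤ m.1) : ℕ) : ZMod p) = 1 := by
  have h := PG_count_sub (l.1 ⊓ m.1)
  simp only [le_inf_iff] at h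
  refine mod_one Fintype.card_pos (hF ▸ dvd_pow_self p two_ne_zero) h ?_
  rw [hF, ← pow_mul]
  apply dvd_pow_self
  obtain ⟨v, hv0, hv1, hv2⟩ := lines_meet l.1 m.1 l.2 m.2
  intro h0
  have : Module.finrank F ↥(l.1 ⊓ m.1) = 0 := by omega
  rw [Submodule.finrank_eq_zero] at this
  have hv : v ∈ l.1 ⊓ m.1 := ⟨hv1, hv2⟩
  rw [this] at hv
  exact hv0 hv


lemma exists_l0 : ∃ l : PGLine F, ∀ v, v ∈ l.1 ↔ v 0 = 0 := by
  refine ⟨⟨LinearMap.ker (LinearMap.proj 0 : (Fin 3 → F) →ₗ[F] F), ?_⟩, ?_⟩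
  · have h := LinearMap.finrank_range_add_finrank_ker (LinearMap.proj 0 : (Fin 3 → F) →ₗ[F] F)
    rw [LinearMap.range_eq_top.2 (LinearMap.proj_surjective 0), finrank_top,
      Module.finrank_self, Module.finrank_fin_fun] at h
    omega
  · intro v; simp

open Classical in
lemma card_zero_first : #(univ.filter fun v : Fin 3 → ZMod p => v 0 = 0) = p ^ 2 := by
  have : #(univ.filter fun v : Fin 3 → ZMod p => v 0 = 0)
      = #(univ : Finset (Fin 2 → ZMod p)) := by
    symm
    apply card_bij (fun w _ => (Fin.cons (α := fun _ => ZMod p) 0 w : Fin 3 → ZMod p))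
    · intro w _; simp
    · intro w _ w' _ h; exact Fin.cons_right_injective _ h
    · intro v hv
      refine ⟨Fin.tail v, mem_univ _, ?_⟩
      rw [← (mem_filter.1 hv).2, Fin.cons_self_tail]
  rw [this, card_univ, Fintype.card_fun, ZMod.card, Fintype.card_fin]

theorem PG_upper (hF : Fintype.card F = p ^ 2) : ∃ c : PGPoint F → ZMod p,
    IsDualCodeWord p (PGIncidence F) c ∧ c ≠ 0 ∧
        (Function.support c).ncard = 2 * p ^ 2 - p := by
  classical
  obtain ⟨l, hl⟩ := exists_l0 (F := F)
  have hp2 := hp.out.two_le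
  obtain ⟨c, hc⟩ : ∃ c : PGPoint F → ZMod p, c = fun P =>
    (if Baer p P then 1 else 0) - (if P.1 ≤ l.1 then 1 else 0) := ⟨_, rfl⟩
  have hBall : #(univ.filter fun P : PGPoint F => Baer p P) = p ^ 2 + p + 1 := by
    have h := Baer_count (F := F) (p := p) ⊤
    simp only [Submodule.mem_top, filter_true, le_top, and_true, card_univ, Fintype.card_fun,
      ZMod.card, Fintype.card_fin] at h
    obtain ⟨q, hq⟩ : ∃ q, p = q + 1 := ⟨p - 1, by omega⟩
    have hq1 : p - 1 = q := by omega
    rw [hq1] at h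
    apply Nat.eq_of_mul_eq_mul_right (show 0 < q by omega)
    generalize #(univ.filter fun P : PGPoint F => Baer p P) = a at h
    rw [hq] at h ⊢
    nlinarith
  have hBl : #(univ.filter fun P : PGPoint F => Baer p P ∧ P.1 ≤ l.1) = p + 1 := by
    have h := Baer_count (F := F) (p := p) l.1
    have h1 : (univ.filter fun v : Fin 3 → ZMod p => emb p v ∈ l.1)
        = univ.filter fun v : Fin 3 → ZMod p => v 0 = 0 := by
      ext v
      simp [hl, emb]
    rw [h1, card_zero_first] at h
    generalize #(univ.filter fun P : PGPoint F => Baer p P ∧ P.1 ≤ l.1) = a at h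
    obtain ⟨q, hq⟩ : ∃ q, p = q + 1 := ⟨p - 1, by omega⟩
    have hq1 : p - 1 = q := by omega
    rw [hq1] at h
    apply Nat.eq_of_mul_eq_mul_right (show 0 < q by omega)
    rw [hq] at h ⊢
    nlinarith
  have hll := PG_card_line l
  rw [hF] at hll
  have hcard : (Function.support c).ncard = 2 * p ^ 2 - p := by
    have hsupp : Function.support c = (((univ.filter fun P : PGPoint F => Baer p P) \
        (univ.filter fun P : PGPoint F => Baer p P ∧ P.1 ≤ l.1)) ∪
        ((univ.filter fun P : PGPoint F => P.1 ≤ l.1) \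
        (univ.filter fun P : PGPoint F => Baer p P ∧ P.1 ≤ l.1)) : Finset (PGPoint F)) := by
      ext P
      by_cases h1 : Baer p P <;> by_cases h2 : P.1 ≤ l.1 <;> simp [hc, h1, h2]
    rw [hsupp, Set.ncard_coe_finset, card_union_of_disjoint, card_sdiff_of_subset,
      card_sdiff_of_subset, hBall, hBl, hll]
    · have : p ≤ p ^ 2 := by nlinarith
      omega
    · intro P; simp
    · intro P hP
      exact mem_filter.2 ⟨mem_univ _, (mem_filter.1 hP).2.1⟩
    · rw [disjoint_left]; intro P; simp; tauto
  refine ⟨c, ?_, ?_, hcard⟩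
  · intro m
    rw [finsum_line]
    have e1 := Baer_line hF m
    have e2 := line_line hF l m
    rw [filter_and, card_eq_sum_ones] at e1 e2
    have : (univ.filter (· ∈ {y : PGPoint F | PGIncidence F y m}))
        = univ.filter fun P : PGPoint F => P.1 ≤ m.1 := by
      ext x
      simp only [mem_filter, mem_univ, true_and]
      exact Iff.rfl
    rw [this, hc, sum_sub_distrib, ← sum_filter, ← sum_filter, filter_filter, filter_filter]
    have e1 := Baer_line hF m
    have e2 := line_line hF l m
    simp only [sum_const, nsmul_eq_mul, mul_one]
    simp only [and_comm] at e1 e2 ⊢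
    rw [e1, e2, sub_self]
  · rintro h
    rw [h] at hcard
    simp at hcard
    nlinarith [Nat.sub_eq_zero_iff_le.1 hcard.symm]

end PGfinal

end

end Helpers

/-- For `p ≥ 7` prime, the minimum weight of the dual code of `PG(2,p²)` is at least
`2p² - 2p + 5` and at most `2p² - p` (the latter weight being attained). -/
theorem dual_code_minimum_weight_PG {p : ℕ} (hp : p.Prime) (hp7 : 7 ≤ p)
    (F : Type) [Field F] [Fintype F] (hF : Fintype.card F = p ^ 2) :
    (∀ c : PGPoint F → ZMod p, IsDualCodeWord p (PGIncidence F) c → c ≠ 0 →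
        2 * p ^ 2 - 2 * p + 5 ≤ (Function.support c).ncard) ∧
    (∃ c : PGPoint F → ZMod p, IsDualCodeWord p (PGIncidence F) c ∧ c ≠ 0 ∧
        (Function.support c).ncard = 2 * p ^ 2 - p) := by
  refine ⟨fun c hc h0 => PG_lower hp hp7 hF c hc h0, ?_⟩
  have : Fact p.Prime := ⟨hp⟩
  have : CharP F p := charP_of_card_eq_prime_pow (f := 2) (by rw [hF])
  letI : Algebra (ZMod p) F := ZMod.algebra F p
  exact PG_upper hF
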